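/- Suppose λ_n = n·p_n → ∞ as n→∞, and set β_n = λ_n/(λ_n−1). Then the hopcount H_n between two uniformly chosen vertices of G_n(p_n), conditioned on the two vertices being connected, satisfies: the conditional law of (H_n − β_n·log n)/√(log n) converges weakly, as n→∞, to the standard normal distribution. -/

import Mathlib

/-!
First passage percolation on the Erdős–Rényi random graph `G_n(p_n)` with i.i.d. rate-1
exponential edge weights.  CLT for the hopcount between two uniformly chosen vertices
(by exchangeability, vertices `0` and `1`), conditioned on the two vertices being connected:
if `n pₙ → λ > 1` and `β = λ/(λ-1)` then `(Hₙ - β log n)/√(β log n) ⇒ N(0,1)`.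
(The graph on `n` vertices is indexed here as `Fin (n+2)` so that the two chosen vertices
always exist; the limit `n → ∞` is unaffected.)
-/

open MeasureTheory ProbabilityTheory Filter Real
open scoped ENNReal NNReal

noncomputable section

/-- The exponential distribution with rate 1 on `ℝ`. -/
def expDist : Measure ℝ :=
  volume.withDensity (fun x => if 0 ≤ x then ENNReal.ofReal (Real.exp (-x)) else 0)

/-- The Bernoulli distribution on `Bool` with success probability `p`. -/
def bernoulliDist (p : ℝ) : Measure Bool :=
  ENNReal.ofReal p • Measure.dirac true + ENNReal.ofReal (1 - p) • Measure.dirac false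

/-- The (random) Erdős–Rényi graph determined by the edge indicators: the first component of
`Z e` tells whether the edge `e` is present. -/
def theGraph {n : ℕ} (Z : Sym2 (Fin n) → Bool × ℝ) : SimpleGraph (Fin n) where
  Adj a b := a ≠ b ∧ (Z s(a, b)).1 = true
  symm := by
    constructor
    intro a b h
    refine ⟨h.1.symm, ?_⟩
    rw [Sym2.eq_swap]
    exact h.2
  loopless := by constructor; intro a h; exact h.1 rfl

/-- Effective edge weights: the exponential weight on present edges, `∞` on absent ones
(and on loops). -/
def effWeight {n : ℕ} (Z : Sym2 (Fin n) → Bool × ℝ) (a b : Fin n) : ℝ≥0∞ :=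
  if a ≠ b ∧ (Z s(a, b)).1 = true then ENNReal.ofReal (Z s(a, b)).2 else ⊤

/-- Total weight of a walk `q` with `k` steps. -/
def walkWeight {n : ℕ} (w : Fin n → Fin n → ℝ≥0∞) {k : ℕ} (q : Fin (k + 1) → Fin n) : ℝ≥0∞ :=
  ∑ t : Fin k, w (q t.castSucc) (q t.succ)

/-- The minimal total weight over all paths (walks) from `i` to `j`; `∞` iff `i`, `j` are
not connected in the graph of finite-weight edges. -/
def minWeight {n : ℕ} (w : Fin n → Fin n → ℝ≥0∞) (i j : Fin n) : ℝ≥0∞ :=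
  ⨅ (k : ℕ) (q : Fin (k + 1) → Fin n) (_ : q 0 = i ∧ q (Fin.last k) = j), walkWeight w q

/-- The hopcount: the number of edges of the minimal-weight path from `i` to `j`
(the minimal number of edges among weight-minimizing walks; almost surely the minimal-weight
path is unique, and then this is its number of edges). -/
def hopCount {n : ℕ} (w : Fin n → Fin n → ℝ≥0∞) (i j : Fin n) : ℕ :=
  sInf {k : ℕ | ∃ q : Fin (k + 1) → Fin n,
    q 0 = i ∧ q (Fin.last k) = j ∧ walkWeight w q = minWeight w i j}

/-- Walks from `D` with accumulated weight and label. -/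
inductive Rch {V : Type*} (D : Finset V) (d : V → ℕ) (W : Sym2 V → ℝ≥0∞) :
    V → ℝ≥0∞ → ℕ → Prop
  | base {u : V} : u ∈ D → Rch D d W u 0 (d u)
  | step {a b : V} {c : ℝ≥0∞} {l : ℕ} : Rch D d W a c l → Rch D d W b (c + W s(a, b)) (l + 1)

def dst {V : Type*} (D : Finset V) (d : V → ℕ) (W : Sym2 V → ℝ≥0∞) (x : V) : ℝ≥0∞ :=
  sInf {c | ∃ l, Rch D d W x c l}

def hop {V : Type*} (D : Finset V) (d : V → ℕ) (W : Sym2 V → ℝ≥0∞) (x : V) : ℕ :=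
  sInf {l | Rch D d W x (dst D d W x) l}

open Classical in
def Phi {V : Type*} (z : ℂ) (D : Finset V) (d : V → ℕ) (x : V) (W : Sym2 V → ℝ≥0∞) : ℂ :=
  if dst D d W x = ⊤ then 0 else z ^ hop D d W x

section det
variable {V : Type*} [DecidableEq V] {D : Finset V} {d : V → ℕ} {W W' : Sym2 V → ℝ≥0∞}
  {u v : V} {x : ℝ≥0∞}

lemma rch_top (hW : ∀ a ∈ D, ∀ b ∉ D, W s(a, b) = ⊤) {y : V} {c : ℝ≥0∞} {l : ℕ}
    (h : Rch D d W y c l) : y ∈ D ∨ c = ⊤ := by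
  induction h with
  | base h => exact Or.inl h
  | @step a b c l _ ih =>
    rcases ih with h | h
    · by_cases hb : b ∈ D
      · exact Or.inl hb
      · right; rw [hW a h b hb]; simp
    · right; simp [h]

lemma phi_top (z : ℂ) (hW : ∀ a ∈ D, ∀ b ∉ D, W s(a, b) = ⊤) {y : V} (hy : y ∉ D) :
    Phi z D d y W = 0 := by
  have : dst D d W y = ⊤ := by
    unfold dst
    rw [sInf_eq_top]
    rintro c ⟨l, hc⟩
    exact (rch_top hW hc).resolve_left hy
  simp [Phi, this]

lemma rch_lower (hu : u ∈ D) (hv : v ∉ D) (hx0 : 0 < x) (hx : x ≠ ⊤)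
    (h1 : W s(u, v) = x)
    (h2 : ∀ a ∈ D, ∀ b ∉ D, (a ≠ u ∨ b ≠ v) → x < W s(a, b))
    (hpos : ∀ e, 0 < W e) {b : V} {c : ℝ≥0∞} {l : ℕ}
    (h : Rch D d W b c l) :
    (b ∈ D ∧ (c = 0 → l = d b)) ∨ (b ∉ D ∧ x ≤ c ∧ (c = x → b = v ∧ l = d u + 1)) := by
  induction h with
  | base h => exact Or.inl ⟨h, fun _ => rfl⟩
  | @step a b c l _ ih =>
    by_cases hb : b ∈ D
    · left
      refine ⟨hb, fun h0 => ?_⟩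
      exact absurd (add_eq_zero.1 h0).2 (hpos _).ne'
    · right
      refine ⟨hb, ?_⟩
      rcases ih with ⟨ha, ih⟩ | ⟨ha, ih1, ih2⟩
      · by_cases hab : a = u ∧ b = v
        · obtain ⟨rfl, rfl⟩ := hab
          rw [h1]
          refine ⟨le_add_self, fun h => ⟨rfl, ?_⟩⟩
          have : c = 0 := by
            have h' : c + x = 0 + x := by simpa using h
            exact (ENNReal.add_left_inj hx).1 h'
          rw [ih this]
        · have hlt := h2 a ha b hb (by tauto)
          have : x < c + W s(a, b) := hlt.trans_le le_add_self
          exact ⟨this.le, fun h => absurd h this.ne'⟩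
      · have : x < c + W s(a, b) := by
          calc x < x + W s(a, b) := ENNReal.lt_add_right hx (hpos _).ne'
            _ ≤ _ := by gcongr
        exact ⟨this.le, fun h => absurd h this.ne'⟩

lemma phi_hit (z : ℂ) (hu : u ∈ D) (hv : v ∉ D) (hx0 : 0 < x) (hx : x ≠ ⊤)
    (h1 : W s(u, v) = x)
    (h2 : ∀ a ∈ D, ∀ b ∉ D, (a ≠ u ∨ b ≠ v) → x < W s(a, b))
    (hpos : ∀ e, 0 < W e) : Phi z D d v W = z ^ (d u + 1) := by
  have hr : Rch D d W v x (d u + 1) := by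
    have := Rch.step (b := v) (Rch.base (d := d) (W := W) hu)
    rwa [h1, zero_add] at this
  have hd : dst D d W v = x := by
    apply le_antisymm
    · exact sInf_le ⟨_, hr⟩
    · refine le_sInf ?_
      rintro c ⟨l, hc⟩
      rcases rch_lower hu hv hx0 hx h1 h2 hpos hc with h | h
      · exact absurd h.1 hv
      · exact h.2.1
  have hh : hop D d W v = d u + 1 := by
    unfold hop
    rw [hd]
    have : {l | Rch D d W v x l} = {d u + 1} := by
      ext l
      simp only [Set.mem_ofPred_eq, Set.mem_singleton_iff]
      constructor
      · intro h
        rcases rch_lower hu hv hx0 hx h1 h2 hpos h with h | h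
        · exact absurd h.1 hv
        · exact (h.2.2 rfl).2
      · rintro rfl; exact hr
    rw [this, csInf_singleton]
  simp [Phi, hd, hh, hx]

lemma rch_zero (hpos : ∀ e, 0 < W e) {a : V} {l : ℕ} {c : ℝ≥0∞} (h : Rch D d W a c l) :
    c = 0 → a ∈ D ∧ l = d a := by
  cases h with
  | base h => exact fun _ => ⟨h, rfl⟩
  | step h => intro h0; exact absurd (add_eq_zero.1 h0).2 (hpos _).ne'

lemma phi_step (z : ℂ) (hu : u ∈ D) (hv : v ∉ D) (hx0 : 0 < x) (hx : x ≠ ⊤)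
    (h1 : W s(u, v) = x)
    (h2 : ∀ a ∈ D, ∀ b ∉ D, (a ≠ u ∨ b ≠ v) → W s(a, b) = W' s(a, b) + x)
    (h3 : ∀ a ∉ D, ∀ b ∉ D, W s(a, b) = W' s(a, b))
    (hpos : ∀ e, 0 < W e) (hpos' : ∀ e, 0 < W' e) {y : V} (hy : y ∉ D) (hyv : y ≠ v) :
    Phi z D d y W = Phi z (insert v D) (Function.update d v (d u + 1)) y W' := by
  set D' := insert v D with hD'
  set d' := Function.update d v (d u + 1) with hd'
  have h2' : ∀ a ∈ D, ∀ b ∉ D, (a ≠ u ∨ b ≠ v) → x < W s(a, b) := by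
    intro a ha b hb hab
    rw [h2 a ha b hb hab, add_comm]
    exact ENNReal.lt_add_right hx (hpos' _).ne'
  have hdD : ∀ a ∈ D, d' a = d a := by
    intro a ha
    rw [hd', Function.update_of_ne]
    rintro rfl; exact hv ha
  have hdv : d' v = d u + 1 := by simp [hd']
  have key1 : ∀ {y c l}, Rch D d W y c l → y ∉ D → y ≠ v →
      ∃ c' l', Rch D' d' W' y c' l' ∧ c' + x ≤ c ∧ (c ≠ ⊤ → c' + x = c → l' = l) := by
    intro y c l h
    induction h with
    | base h => intro h'; exact absurd h h'
    | @step a b c l hr ih =>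
      intro hb hbv
      by_cases ha : a ∈ D
      · refine ⟨0 + W' s(a, b), d' a + 1, Rch.step (Rch.base (by simp [hD', ha])), ?_, ?_⟩
        · rw [h2 a ha b hb (Or.inr hbv), zero_add]; exact le_add_self
        · intro hc he
          rw [h2 a ha b hb (Or.inr hbv), zero_add] at he
          rw [h2 a ha b hb (Or.inr hbv)] at hc
          have hc' : W' s(a, b) + x ≠ ⊤ := fun h => hc (by simp [h])
          have : c = 0 := by
            have h' : c + (W' s(a, b) + x) = 0 + (W' s(a, b) + x) := by rw [zero_add]; exact he.symm
            exact (ENNReal.add_left_inj hc').1 h'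
          rw [hdD a ha, (rch_zero hpos hr this).2]
      · by_cases hav : a = v
        · subst hav
          obtain h | ⟨_, h4, h5⟩ := rch_lower hu hv hx0 hx h1 h2' hpos hr
          · exact absurd h.1 ha
          · refine ⟨0 + W' s(a, b), d' a + 1, Rch.step (Rch.base (by simp [hD'])), ?_, ?_⟩
            · rw [zero_add, h3 a ha b hb, add_comm]; gcongr
            · intro hc he
              rw [zero_add, h3 a ha b hb, add_comm] at he
              rw [h3 a ha b hb] at hc
              have hc' : W' s(a, b) ≠ ⊤ := fun h => hc (by simp [h])
              have := (ENNReal.add_left_inj hc').1 he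
              rw [(h5 this.symm).2, hdv]
        · obtain ⟨c', l', hr', hle, he⟩ := ih ha hav
          refine ⟨c' + W' s(a, b), l' + 1, Rch.step hr', ?_, ?_⟩
          · rw [h3 a ha b hb, add_right_comm]; gcongr
          · intro hc h
            rw [h3 a ha b hb] at hc h
            rw [add_right_comm] at h
            have hc' : W' s(a, b) ≠ ⊤ := fun h => hc (by simp [h])
            have hc'' : c ≠ ⊤ := fun h => hc (by simp [h])
            rw [he hc'' ((ENNReal.add_left_inj hc').1 h)]
  have key2 : ∀ {y c' l'}, Rch D' d' W' y c' l' → y ∉ D → y ≠ v →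
      ∃ c l, Rch D d W y c l ∧ c ≤ c' + x ∧ (c' ≠ ⊤ → c = c' + x → l = l') := by
    intro y c l h
    induction h with
    | base h => intro h' h''; simp [hD', h', h''] at h
    | @step a b c l hr ih =>
      intro hb hbv
      by_cases ha : a ∈ D
      · refine ⟨0 + W s(a, b), d a + 1, Rch.step (Rch.base ha), ?_, ?_⟩
        · rw [h2 a ha b hb (Or.inr hbv), zero_add, add_assoc]; exact le_add_self
        · intro hc he
          rw [h2 a ha b hb (Or.inr hbv), zero_add, ENNReal.add_left_inj hx] at he
          have hc' : W' s(a, b) ≠ ⊤ := fun h => hc (by simp [h])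
          have : c = 0 := by
            have h' : c + (W' s(a, b)) = 0 + (W' s(a, b)) := by rw [zero_add]; exact he.symm
            exact (ENNReal.add_left_inj hc').1 h'
          rw [(rch_zero hpos' hr this).2, hdD a ha]
      · by_cases hav : a = v
        · subst hav
          refine ⟨0 + W s(u, a) + W s(a, b), d u + 1 + 1, Rch.step (Rch.step (Rch.base hu)), ?_, ?_⟩
          · rw [zero_add, h3 a ha b hb, h1, add_right_comm]; gcongr; exact le_add_self
          · intro hc he
            rw [zero_add, h3 a ha b hb, h1, add_comm x, ENNReal.add_left_inj hx] at he
            have hc' : W' s(a, b) ≠ ⊤ := fun h => hc (by simp [h])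
            have : c = 0 := by
              have h' : c + (W' s(a, b)) = 0 + (W' s(a, b)) := by rw [zero_add]; exact he.symm
              exact (ENNReal.add_left_inj hc').1 h'
            rw [(rch_zero hpos' hr this).2, hdv]
        · obtain ⟨c', l', hr', hle, he⟩ := ih ha hav
          refine ⟨c' + W s(a, b), l' + 1, Rch.step hr', ?_, ?_⟩
          · rw [h3 a ha b hb, add_right_comm]; gcongr
          · intro hc h
            rw [h3 a ha b hb, add_right_comm] at h
            have hc' : W' s(a, b) ≠ ⊤ := fun h => hc (by simp [h])
            have hc'' : c ≠ ⊤ := fun h => hc (by simp [h])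
            rw [he hc'' ((ENNReal.add_left_inj hc').1 h)]
  have hdst : dst D d W y = dst D' d' W' y + x := by
    apply le_antisymm
    · unfold dst
      rw [ENNReal.sInf_add]
      refine le_iInf₂ ?_
      rintro c ⟨l, hc⟩
      obtain ⟨c0, l0, hr, hle, -⟩ := key2 hc hy hyv
      refine le_trans (sInf_le ?_) hle
      exact ⟨l0, hr⟩
    · refine le_sInf ?_
      rintro c ⟨l, hc⟩
      obtain ⟨c0, l0, hr, hle, -⟩ := key1 hc hy hyv
      refine le_trans ?_ hle
      gcongr
      exact sInf_le ⟨l0, hr⟩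
  by_cases htop : dst D' d' W' y = ⊤
  · have : dst D d W y = ⊤ := by rw [hdst, htop]; simp
    simp [Phi, this, htop]
  have htop' : dst D d W y ≠ ⊤ := by rw [hdst]; simp [htop, hx]
  have hhop : hop D d W y = hop D' d' W' y := by
    unfold hop
    congr 1
    ext l
    simp only [Set.mem_ofPred_eq]
    constructor
    · intro h
      obtain ⟨c', l', hr, hle, he⟩ := key1 h hy hyv
      have hge : dst D' d' W' y ≤ c' := sInf_le ⟨l', hr⟩
      rw [hdst] at hle
      have hc : c' = dst D' d' W' y := le_antisymm ((ENNReal.add_le_add_iff_right hx).1 hle) hge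
      have := he htop' (by rw [hc, hdst])
      rw [← this, ← hc]; exact hr
    · intro h
      obtain ⟨c', l', hr, hle, he⟩ := key2 h hy hyv
      have hge : dst D d W y ≤ c' := sInf_le ⟨l', hr⟩
      have hc : c' = dst D d W y := le_antisymm (by rw [hdst]; exact hle) hge
      have := he htop (by rw [hc, hdst])
      rw [← this, ← hc]; exact hr
  simp [Phi, htop, htop', hhop]

end det

lemma rch_iff {V : Type*} {D : Finset V} {d : V → ℕ} {W : Sym2 V → ℝ≥0∞} {x : V} {c : ℝ≥0∞}
    {l : ℕ} : Rch D d W x c l ↔ ∃ (k : ℕ) (q : Fin (k + 1) → V), (q 0 ∈ D ∧ q (Fin.last k) = x) ∧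
      c = ∑ t : Fin k, W s(q t.castSucc, q t.succ) ∧ l = d (q 0) + k := by
  constructor
  · intro h
    induction h with
    | @base u h => exact ⟨0, fun _ => u, ⟨h, rfl⟩, by simp, rfl⟩
    | @step a b c l _ ih =>
      obtain ⟨k, q, ⟨h0, hl⟩, hc, hl'⟩ := ih
      refine ⟨k + 1, Fin.snoc (α := fun _ => V) q b, ⟨?_, ?_⟩, ?_, ?_⟩
      · have : (0 : Fin (k + 1 + 1)) = Fin.castSucc 0 := rfl
        rw [this, Fin.snoc_castSucc]; exact h0
      · simp
      · rw [Fin.sum_univ_castSucc, hc]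
        congr 1
        · refine Finset.sum_congr rfl fun t _ => ?_
          rw [Fin.succ_castSucc, Fin.snoc_castSucc, Fin.snoc_castSucc]
        · rw [Fin.succ_last, Fin.snoc_last, Fin.snoc_castSucc, hl]
      · have : (0 : Fin (k + 1 + 1)) = Fin.castSucc 0 := rfl
        rw [this, Fin.snoc_castSucc, hl']; ring
  · rintro ⟨k, q, ⟨h0, hl⟩, hc, hl'⟩
    induction k generalizing x c l with
    | zero =>
      have : x = q 0 := by rw [← hl]; rfl
      subst this
      simp at hc hl'
      subst hc hl'
      exact Rch.base h0
    | succ k ih =>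
      have := ih (x := q (Fin.last k).castSucc) (c := _) (l := d (q 0) + k)
        (fun t => q t.castSucc) h0 rfl rfl rfl
      have h' := Rch.step (b := x) this
      rw [Fin.sum_univ_castSucc, Fin.succ_last, hl] at hc
      have hl2 : l = d (q 0) + k + 1 := by rw [hl']; ring
      rw [hc, hl2]
      exact h'

section meas
variable {V : Type*} [Fintype V] [DecidableEq V] (D : Finset V) (d : V → ℕ) (x : V)

lemma dst_eq (W : Sym2 V → ℝ≥0∞) : dst D d W x =
    ⨅ (k : ℕ) (q : Fin (k + 1) → V) (_ : q 0 ∈ D ∧ q (Fin.last k) = x),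
      ∑ t : Fin k, W s(q t.castSucc, q t.succ) := by
  unfold dst
  apply le_antisymm
  · refine le_iInf fun k => le_iInf fun q => le_iInf fun h => sInf_le ?_
    exact ⟨_, rch_iff.2 ⟨k, q, h, rfl, rfl⟩⟩
  · refine le_sInf ?_
    rintro c ⟨l, hc⟩
    obtain ⟨k, q, h, rfl, -⟩ := rch_iff.1 hc
    exact iInf_le_of_le k (iInf_le_of_le q (iInf_le_of_le h le_rfl))

lemma measurable_dst : Measurable (fun W => dst D d W x) := by
  simp_rw [dst_eq]
  refine Measurable.iInf fun k => Measurable.iInf fun q => Measurable.iInf fun _ => ?_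
  fun_prop

lemma measurableSet_rch (l : ℕ) : MeasurableSet {W | Rch D d W x (dst D d W x) l} := by
  have : {W | Rch D d W x (dst D d W x) l} = ⋃ (k : ℕ), ⋃ (q : Fin (k + 1) → V),
      ⋃ (_ : (q 0 ∈ D ∧ q (Fin.last k) = x) ∧ l = d (q 0) + k),
      {W | dst D d W x = ∑ t : Fin k, W s(q t.castSucc, q t.succ)} := by
    ext W
    simp only [Set.mem_ofPred_eq, Set.mem_iUnion, rch_iff]
    constructor
    · rintro ⟨k, q, h1, h2, h3⟩; exact ⟨k, q, ⟨h1, h3⟩, h2⟩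
    · rintro ⟨k, q, ⟨h1, h3⟩, h2⟩; exact ⟨k, q, h1, h2, h3⟩
  rw [this]
  refine MeasurableSet.iUnion fun k => MeasurableSet.iUnion fun q => MeasurableSet.iUnion fun _ => ?_
  exact measurableSet_eq_fun (measurable_dst D d x) (by fun_prop)

lemma measurable_hop : Measurable (fun W => hop D d W x) := by
  refine measurable_to_countable' fun n => ?_
  have : (fun W => hop D d W x) ⁻¹' {n} =
      ({W | Rch D d W x (dst D d W x) n} ∩ ⋂ (m : ℕ) (_ : m < n), {W | Rch D d W x (dst D d W x) m}ᶜ)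
      ∪ ((if n = 0 then Set.univ else ∅) ∩ ⋂ (m : ℕ), {W | Rch D d W x (dst D d W x) m}ᶜ) := by
    ext W
    simp only [Set.mem_preimage, Set.mem_singleton_iff, Set.mem_union, Set.mem_inter_iff,
      Set.mem_iInter, Set.mem_compl_iff, Set.mem_ofPred_eq]
    unfold hop
    constructor
    · rintro rfl
      by_cases he : {l | Rch D d W x (dst D d W x) l}.Nonempty
      · left
        refine ⟨Nat.sInf_mem he, fun m hm => ?_⟩
        exact fun h => Nat.notMem_of_lt_sInf hm h
      · right
        rw [Set.not_nonempty_iff_eq_empty] at he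
        refine ⟨by simp [he], fun m hm => ?_⟩
        have : m ∈ {l | Rch D d W x (dst D d W x) l} := hm
        rw [he] at this; exact this
    · rintro (⟨h1, h2⟩ | ⟨h1, h2⟩)
      · apply le_antisymm
        · exact Nat.sInf_le h1
        · by_contra hlt
          push Not at hlt
          exact h2 _ hlt (Nat.sInf_mem (s := {l | Rch D d W x (dst D d W x) l}) ⟨n, h1⟩)
      · have he : {l | Rch D d W x (dst D d W x) l} = ∅ := by
          ext m; simp [h2 m]
        rw [he]
        by_cases h0 : n = 0
        · simp [h0]
        · simp [h0] at h1
  rw [this]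
  refine MeasurableSet.union (MeasurableSet.inter (measurableSet_rch D d x n) ?_)
    (MeasurableSet.inter ?_ ?_)
  · exact MeasurableSet.iInter fun m => MeasurableSet.iInter fun _ =>
      (measurableSet_rch D d x m).compl
  · split_ifs <;> simp
  · exact MeasurableSet.iInter fun m => (measurableSet_rch D d x m).compl

lemma measurable_Phi (z : ℂ) : Measurable (Phi z D d x) := by
  unfold Phi
  refine Measurable.ite ?_ measurable_const ?_
  · exact measurable_dst D d x (measurableSet_singleton ⊤)
  · exact (measurable_of_countable (fun n : ℕ => z ^ n)).comp (measurable_hop D d x)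

end meas

lemma norm_Phi_le {V : Type*} (D : Finset V) (d : V → ℕ) (x : V) {z : ℂ} (hz : ‖z‖ = 1)
    (W : Sym2 V → ℝ≥0∞) : ‖Phi z D d x W‖ ≤ 1 := by
  unfold Phi
  split_ifs <;> simp [hz]

/-- weights from the data -/
def wt {n : ℕ} (Z : Sym2 (Fin n) → Bool × ℝ) (e : Sym2 (Fin n)) : ℝ≥0∞ :=
  if ¬ e.IsDiag ∧ (Z e).1 = true then ENNReal.ofReal (Z e).2 else ⊤

lemma effWeight_eq {n : ℕ} (Z : Sym2 (Fin n) → Bool × ℝ) (a b : Fin n) :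
    effWeight Z a b = wt Z s(a, b) := by
  simp [effWeight, wt]

lemma minWeight_eq {n : ℕ} (Z : Sym2 (Fin n) → Bool × ℝ) (i j : Fin n) :
    minWeight (effWeight Z) i j = dst {i} (fun _ => 0) (wt Z) j := by
  rw [dst_eq]
  simp [minWeight, walkWeight, effWeight_eq]

lemma hopCount_eq {n : ℕ} (Z : Sym2 (Fin n) → Bool × ℝ) (i j : Fin n) :
    hopCount (effWeight Z) i j = hop {i} (fun _ => 0) (wt Z) j := by
  unfold hopCount hop
  congr 1
  ext l
  rw [minWeight_eq]
  simp only [Set.mem_ofPred_eq, rch_iff, walkWeight, effWeight_eq]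
  constructor
  · rintro ⟨q, h1, h2, h3⟩
    exact ⟨l, q, ⟨by simp [h1], h2⟩, h3.symm, by simp⟩
  · rintro ⟨k, q, ⟨h1, h2⟩, h3, h4⟩
    have : l = k := by simpa using h4
    subst this
    exact ⟨q, by simpa using h1, h2, h3.symm⟩

lemma reach_iff {n : ℕ} (Z : Sym2 (Fin n) → Bool × ℝ) (i j : Fin n) :
    (theGraph Z).Reachable i j ↔ dst {i} (fun _ => 0) (wt Z) j ≠ ⊤ := by
  have hadj : ∀ a b, (theGraph Z).Adj a b ↔ wt Z s(a, b) ≠ ⊤ := by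
    intro a b
    simp [theGraph, wt]
  constructor
  · intro h
    rw [SimpleGraph.reachable_iff_reflTransGen] at h
    have : ∃ c l, Rch {i} (fun _ => 0) (wt Z) j c l ∧ c ≠ ⊤ := by
      induction h with
      | refl => exact ⟨0, 0, Rch.base (d := fun _ => 0) (by simp), by simp⟩
      | @tail b c _ hbc ih =>
        obtain ⟨c', l, hr, hc⟩ := ih
        exact ⟨_, _, Rch.step (b := c) hr, by simp [hc, (hadj _ _).1 hbc]⟩
    obtain ⟨c, l, hr, hc⟩ := this
    exact fun h => hc (top_le_iff.1 (h ▸ (sInf_le ⟨l, hr⟩ : dst {i} (fun _ => 0) (wt Z) j ≤ c)))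
  · intro h
    have : ∃ c l, Rch {i} (fun _ => 0) (wt Z) j c l ∧ c ≠ ⊤ := by
      by_contra hne
      push Not at hne
      apply h
      unfold dst
      rw [sInf_eq_top]
      rintro c ⟨l, hc⟩
      exact hne c l hc
    obtain ⟨c, l, hr, hc⟩ := this
    clear h
    induction hr with
    | base h => simp at h; subst h; exact SimpleGraph.Reachable.refl _
    | @step a b c l _ ih =>
      rw [ENNReal.add_ne_top] at hc
      exact (ih hc.1).trans (SimpleGraph.Adj.reachable ((hadj _ _).2 hc.2))

lemma Phi_eq {n : ℕ} (z : ℂ) (Z : Sym2 (Fin n) → Bool × ℝ) (i j : Fin n) :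
    ((theGraph Z).Reachable i j → Phi z {i} (fun _ => 0) j (wt Z) = z ^ hopCount (effWeight Z) i j) ∧
    (¬ (theGraph Z).Reachable i j → Phi z {i} (fun _ => 0) j (wt Z) = 0) := by
  rw [reach_iff, hopCount_eq]
  unfold Phi
  split_ifs <;> simp_all

lemma expDist_eq : expDist =
    (volume.restrict (Set.Ioi 0)).withDensity (fun x => ENNReal.ofReal (Real.exp (-x))) := by
  have h1 : (fun x : ℝ => if 0 ≤ x then ENNReal.ofReal (Real.exp (-x)) else 0) =
      (Set.Ici (0 : ℝ)).indicator (fun x => ENNReal.ofReal (Real.exp (-x))) := by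
    ext x; simp [Set.indicator]
  unfold expDist
  rw [h1, withDensity_indicator measurableSet_Ici, Measure.restrict_congr_set Ioi_ae_eq_Ici]

lemma lintegral_expDist {f : ℝ → ℝ≥0∞} (hf : Measurable f) :
    ∫⁻ x, f x ∂expDist = ∫⁻ x in Set.Ioi 0, ENNReal.ofReal (Real.exp (-x)) * f x := by
  rw [expDist_eq, lintegral_withDensity_eq_lintegral_mul _ (by fun_prop) hf]
  rfl

instance : IsProbabilityMeasure expDist := by
  constructor
  have := lintegral_expDist (f := fun _ => 1) measurable_const
  rw [lintegral_const, one_mul] at this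
  rw [this]
  simp only [mul_one]
  rw [← ofReal_integral_eq_lintegral_ofReal, integral_exp_neg_Ioi_zero, ENNReal.ofReal_one]
  · exact integrableOn_exp_neg_Ioi 0
  · exact ae_of_all _ fun x => (Real.exp_pos _).le

/-- law of an edge weight: exponential with probability `h`, infinite otherwise -/
def nu (h : ℝ) : Measure ℝ≥0∞ :=
  ENNReal.ofReal h • expDist.map ENNReal.ofReal + ENNReal.ofReal (1 - h) • Measure.dirac ⊤

instance (h : ℝ) : IsFiniteMeasure (nu h) := by
  haveI : IsProbabilityMeasure (expDist.map ENNReal.ofReal) :=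
    Measure.isProbabilityMeasure_map (by fun_prop)
  constructor
  simp [nu]

lemma nu_prob {h : ℝ} (h0 : 0 ≤ h) (h1 : h ≤ 1) : IsProbabilityMeasure (nu h) := by
  haveI : IsProbabilityMeasure (expDist.map ENNReal.ofReal) :=
    Measure.isProbabilityMeasure_map (by fun_prop)
  constructor
  simp only [nu, Measure.coe_add, Measure.coe_smul, Pi.add_apply, Pi.smul_apply, measure_univ,
    smul_eq_mul, mul_one]
  rw [← ENNReal.ofReal_add h0 (by linarith)]
  simp

lemma lintegral_nu (h : ℝ) {f : ℝ≥0∞ → ℝ≥0∞} (hf : Measurable f) :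
    ∫⁻ x, f x ∂(nu h) = ENNReal.ofReal h *
      (∫⁻ x in Set.Ioi (0 : ℝ), ENNReal.ofReal (Real.exp (-x)) * f (ENNReal.ofReal x))
      + ENNReal.ofReal (1 - h) * f ⊤ := by
  rw [nu, lintegral_add_measure, lintegral_smul_measure, lintegral_smul_measure,
    lintegral_map hf (by fun_prop), lintegral_expDist (by fun_prop), lintegral_dirac]
  rfl

def qf (h x : ℝ) : ℝ := 1 - h + h * Real.exp (-x)
def hs (h x : ℝ) : ℝ := h * Real.exp (-x) / qf h x

lemma qf_pos {h x : ℝ} (h0 : 0 ≤ h) (h1 : h ≤ 1) : 0 < qf h x := by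
  unfold qf
  rcases eq_or_lt_of_le h0 with h | h
  · rw [← h]; simp
  · have := mul_pos h (Real.exp_pos (-x)); linarith

lemma hs_nonneg {h x : ℝ} (h0 : 0 ≤ h) (h1 : h ≤ 1) : 0 ≤ hs h x :=
  div_nonneg (mul_nonneg h0 (Real.exp_pos _).le) (qf_pos h0 h1).le

lemma hs_le_one {h x : ℝ} (h0 : 0 ≤ h) (h1 : h ≤ 1) : hs h x ≤ 1 := by
  unfold hs
  rw [div_le_one (qf_pos h0 h1)]
  unfold qf; linarith

lemma nu_restrict {h t : ℝ} (h0 : 0 ≤ h) (h1 : h ≤ 1) (ht : 0 ≤ t) :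
    (nu h).restrict (Set.Ioi (ENNReal.ofReal t)) =
      ENNReal.ofReal (qf h t) • (nu (hs h t)).map (fun y => y + ENNReal.ofReal t) := by
  have hq := qf_pos (x := t) h0 h1
  refine Measure.ext_of_lintegral _ fun f hf => ?_
  rw [← lintegral_indicator measurableSet_Ioi, lintegral_nu _ (hf.indicator measurableSet_Ioi),
    lintegral_smul_measure, lintegral_map hf (by fun_prop), lintegral_nu _ (by fun_prop)]
  rw [smul_eq_mul, mul_add, ← mul_assoc, ← mul_assoc, ← ENNReal.ofReal_mul hq.le,
    ← ENNReal.ofReal_mul hq.le]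
  have e1 : qf h t * hs h t = h * Real.exp (-t) := by unfold hs; field_simp
  have e2 : qf h t * (1 - hs h t) = 1 - h := by
    rw [mul_sub, e1]; unfold qf; ring
  rw [e1, e2]
  congr 1
  · rw [ENNReal.ofReal_mul h0, mul_assoc]
    congr 1
    rw [← lintegral_const_mul _ (by fun_prop), ← lintegral_indicator measurableSet_Ioi,
      ← lintegral_indicator measurableSet_Ioi,
      ← lintegral_add_right_eq_self (μ := (volume : Measure ℝ)) _ t]
    refine lintegral_congr fun x => ?_
    by_cases hx : 0 < x
    · have hx' : (0:ℝ) < x + t := by linarith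
      simp only [Set.indicator, Set.mem_Ioi, hx, hx', if_true]
      rw [if_pos (by rw [ENNReal.ofReal_lt_ofReal_iff hx']; linarith), ← mul_assoc,
        ← ENNReal.ofReal_mul (Real.exp_pos _).le, ← Real.exp_add,
        ENNReal.ofReal_add hx.le ht]
      congr 3
      ring
    · have : ¬ (ENNReal.ofReal t < ENNReal.ofReal (x + t)) := by
        rw [not_lt]; exact ENNReal.ofReal_le_ofReal (by linarith)
      simp [Set.indicator, hx, this]
  · simp

lemma nu_zero (h : ℝ) : nu h {0} = 0 := by
  have := lintegral_nu h (f := Set.indicator {0} 1) (measurable_one.indicator (measurableSet_singleton _))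
  rw [lintegral_indicator_one (measurableSet_singleton _)] at this
  rw [this]
  have : ∫⁻ x in Set.Ioi (0 : ℝ), ENNReal.ofReal (Real.exp (-x)) *
      (Set.indicator {0} 1 : ℝ≥0∞ → ℝ≥0∞) (ENNReal.ofReal x) = ∫⁻ x in Set.Ioi (0 : ℝ), 0 := by
    refine setLIntegral_congr_fun measurableSet_Ioi fun x hx => ?_
    have : ¬ (x ≤ 0) := not_le.2 hx
    simp [Set.indicator, this]
  rw [this]
  simp [Set.indicator]

lemma nu_atom (h : ℝ) {c : ℝ≥0∞} (hc : c ≠ ⊤) : nu h {c} = 0 := by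
  have := lintegral_nu h (f := Set.indicator {c} 1) (measurable_one.indicator (measurableSet_singleton _))
  rw [lintegral_indicator_one (measurableSet_singleton _)] at this
  rw [this]
  have : ∫⁻ x in Set.Ioi (0 : ℝ), ENNReal.ofReal (Real.exp (-x)) *
      (Set.indicator {c} 1 : ℝ≥0∞ → ℝ≥0∞) (ENNReal.ofReal x) = ∫⁻ x in Set.Ioi (0 : ℝ), 0 := by
    refine setLIntegral_congr_fun_ae measurableSet_Ioi ?_
    have : ∀ᵐ x : ℝ, x ≠ c.toReal := Measure.ae_ne volume _
    filter_upwards [this] with x hx hx0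
    have : ENNReal.ofReal x ≠ c := by
      intro h; apply hx; rw [← h, ENNReal.toReal_ofReal (le_of_lt hx0)]
    simp [Set.indicator, this]
  rw [this]
  simp [Set.indicator, hc.symm]

lemma integral_nu {h : ℝ} (h0 : 0 ≤ h) {f : ℝ≥0∞ → ℂ} (hf : Integrable f (nu h))
    (hfm : StronglyMeasurable f) (hft : f ⊤ = 0) :
    ∫ x, f x ∂(nu h) = ∫ x in Set.Ioi (0 : ℝ), ((h * Real.exp (-x) : ℝ) : ℂ) * f (ENNReal.ofReal x) ∧
    IntegrableOn (fun x : ℝ => ((h * Real.exp (-x) : ℝ) : ℂ) * f (ENNReal.ofReal x)) (Set.Ioi 0) := by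
  have hm : Measurable fun x : ℝ => ENNReal.ofReal (Real.exp (-x)) := by fun_prop
  have hlt : ∀ᵐ x ∂(volume.restrict (Set.Ioi (0:ℝ))), ENNReal.ofReal (Real.exp (-x)) < ⊤ := by simp
  constructor
  · rw [nu] at hf ⊢
    rw [integral_add_measure (hf.mono_measure (Measure.le_add_right le_rfl))
      (hf.mono_measure (Measure.le_add_left le_rfl)), integral_smul_measure, integral_smul_measure,
      integral_dirac, hft, smul_zero, add_zero, integral_map (by fun_prop)
      hfm.aestronglyMeasurable, expDist_eq,
      integral_withDensity_eq_integral_toReal_smul hm hlt, ENNReal.toReal_ofReal h0,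
      ← integral_smul]
    refine integral_congr_ae (ae_of_all _ fun x => ?_)
    simp only [ENNReal.toReal_ofReal (Real.exp_pos _).le, Complex.real_smul]
    push_cast; ring
  · rcases eq_or_lt_of_le h0 with h | hpos
    · rw [← h]; simp
    rw [nu] at hf
    have h1 := hf.mono_measure (Measure.le_add_right (ν := ENNReal.ofReal h • expDist.map ENNReal.ofReal) le_rfl)
    rw [integrable_smul_measure (by simpa using hpos) (by simp), integrable_map_measure hfm.aestronglyMeasurable
      (by fun_prop), expDist_eq, integrable_withDensity_iff_integrable_smul' hm hlt] at h1
    have := h1.smul h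
    refine this.congr (ae_of_all _ fun x => ?_)
    simp only [Pi.smul_apply, Function.comp, ENNReal.toReal_ofReal (Real.exp_pos _).le, Complex.real_smul]
    push_cast; ring

section onestep
variable {ι : Type*} [Fintype ι] [DecidableEq ι]

abbrev piNu (h : ι → ℝ) : Measure (ι → ℝ≥0∞) := Measure.pi (fun i => nu (h i))

lemma measurable_upd (e : ι) :
    Measurable (fun q : ℝ≥0∞ × (ι → ℝ≥0∞) => Function.update q.2 e q.1) := by
  rw [measurable_pi_iff]
  intro i
  by_cases hi : i = e
  · subst hi; simpa using measurable_fst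
  · simp only [Function.update_of_ne hi]; fun_prop

lemma upd_map {h : ι → ℝ} (hh : ∀ i, 0 ≤ h i ∧ h i ≤ 1) (e : ι) :
    ((nu (h e)).prod (piNu h)).map (fun q => Function.update q.2 e q.1) = piNu h := by
  haveI : ∀ i, IsProbabilityMeasure (nu (h i)) := fun i => nu_prob (hh i).1 (hh i).2
  symm
  refine Measure.pi_eq fun s hs => ?_
  rw [Measure.map_apply (measurable_upd e) (MeasurableSet.univ_pi hs)]
  have : (fun q : ℝ≥0∞ × (ι → ℝ≥0∞) => Function.update q.2 e q.1) ⁻¹' (Set.univ.pi s) =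
      (s e) ×ˢ (Set.univ.pi (Function.update s e Set.univ)) := by
    ext ⟨x, W⟩
    simp only [Set.mem_preimage, Set.mem_pi, Set.mem_univ, true_imp_iff, Set.mem_prod]
    constructor
    · intro H
      refine ⟨by simpa using H e, fun i => ?_⟩
      by_cases hi : i = e
      · subst hi; simp
      · have := H i; simpa [hi] using this
    · rintro ⟨H1, H2⟩ i
      by_cases hi : i = e
      · subst hi; simpa using H1
      · have := H2 i; simpa [hi] using this
  rw [this, Measure.prod_prod, Measure.pi_pi]
  rw [← Finset.mul_prod_erase Finset.univ (fun i => nu (h i) (s i)) (Finset.mem_univ e),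
    ← Finset.mul_prod_erase Finset.univ _ (Finset.mem_univ e)]
  simp only [Function.update_self, measure_univ, one_mul]
  congr 1
  refine Finset.prod_congr rfl fun i hi => ?_
  rw [Function.update_of_ne (Finset.ne_of_mem_erase hi)]

def hsx (J : Finset ι) (x : ℝ) (h : ι → ℝ) : ι → ℝ := fun i => if i ∈ J then hs (h i) x else h i

lemma hsx_mem {h : ι → ℝ} (hh : ∀ i, 0 ≤ h i ∧ h i ≤ 1) (J : Finset ι) (x : ℝ) (i : ι) :
    0 ≤ hsx J x h i ∧ hsx J x h i ≤ 1 := by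
  unfold hsx
  split_ifs
  · exact ⟨hs_nonneg (hh i).1 (hh i).2, hs_le_one (hh i).1 (hh i).2⟩
  · exact hh i

def shf (J : Finset ι) (x : ℝ≥0∞) (W : ι → ℝ≥0∞) : ι → ℝ≥0∞ :=
  fun i => if i ∈ J then W i + x else W i

lemma measurable_shf (J : Finset ι) (x : ℝ≥0∞) : Measurable (shf J x) := by
  rw [measurable_pi_iff]
  intro i
  unfold shf
  split_ifs <;> fun_prop

lemma pi_restrict {h : ι → ℝ} (hh : ∀ i, 0 ≤ h i ∧ h i ≤ 1) (J : Finset ι) {x : ℝ} (hx : 0 ≤ x) :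
    (piNu h).restrict {W | ∀ i ∈ J, ENNReal.ofReal x < W i} =
      ENNReal.ofReal (∏ i ∈ J, qf (h i) x) • (piNu (hsx J x h)).map (shf J (ENNReal.ofReal x)) := by
  have hset : {W : ι → ℝ≥0∞ | ∀ i ∈ J, ENNReal.ofReal x < W i} =
      Set.univ.pi (fun i => if i ∈ J then Set.Ioi (ENNReal.ofReal x) else Set.univ) := by
    ext W
    simp only [Set.mem_ofPred_eq, Set.mem_pi, Set.mem_univ, true_imp_iff]
    refine forall_congr' fun i => ?_
    split_ifs with hi <;> simp [hi]
  rw [hset, Measure.restrict_pi_pi]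
  refine Measure.pi_eq fun s hs' => ?_
  rw [Measure.smul_apply, Measure.map_apply (measurable_shf _ _) (MeasurableSet.univ_pi hs')]
  have : shf J (ENNReal.ofReal x) ⁻¹' Set.univ.pi s = Set.univ.pi (fun i =>
      (fun y => if i ∈ J then y + ENNReal.ofReal x else y) ⁻¹' (s i)) := by
    ext W; simp [shf]
  rw [this, Measure.pi_pi, ENNReal.ofReal_prod_of_nonneg
    (fun i _ => (qf_pos (hh i).1 (hh i).2).le), smul_eq_mul]
  have h2 : ∏ i ∈ J, ENNReal.ofReal (qf (h i) x) =
      ∏ i, if i ∈ J then ENNReal.ofReal (qf (h i) x) else 1 := by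
    rw [Finset.prod_ite_mem]; simp
  rw [h2, ← Finset.prod_mul_distrib]
  refine Finset.prod_congr rfl fun i _ => ?_
  unfold hsx
  split_ifs with hi
  · rw [nu_restrict (hh i).1 (hh i).2 hx, Measure.smul_apply, Measure.map_apply (by fun_prop) (hs' i),
      smul_eq_mul]
  · simp

lemma ae_pos (h : ι → ℝ) : ∀ᵐ W ∂(piNu h), ∀ i, 0 < W i := by
  rw [ae_all_iff]
  intro i
  have h1 : ∀ᵐ x ∂(nu (h i)), 0 < x := by
    rw [ae_iff]
    have : {a : ℝ≥0∞ | ¬ 0 < a} = {0} := by ext a; simp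
    rw [this]; exact nu_zero _
  exact Measure.tendsto_eval_ae_ae.eventually h1

lemma ae_ne {h : ι → ℝ} (hh : ∀ i, 0 ≤ h i ∧ h i ≤ 1) {e e' : ι} (hne : e ≠ e') :
    ∀ᵐ W ∂(piNu h), W e = W e' → W e = ⊤ := by
  have hmeas : MeasurableSet {W : ι → ℝ≥0∞ | ¬ (W e = W e' → W e = ⊤)} := by
    have : {W : ι → ℝ≥0∞ | ¬ (W e = W e' → W e = ⊤)} = {W | W e = W e'} ∩ {W | W e = ⊤}ᶜ := by
      ext W; simp
    rw [this]
    exact (measurableSet_eq_fun (by fun_prop) (by fun_prop)).inter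
      (measurableSet_eq_fun (by fun_prop) (by fun_prop)).compl
  rw [ae_iff, ← upd_map hh e, Measure.map_apply (measurable_upd e) hmeas,
    Measure.prod_apply_symm (measurable_upd e hmeas), lintegral_eq_zero_iff']
  · refine ae_of_all _ fun W => ?_
    simp only [Pi.zero_apply]
    by_cases hW : W e' = ⊤
    · convert measure_empty (μ := nu (h e))
      ext x
      simp [Function.update_of_ne hne.symm, hW]
    · refine measure_mono_null ?_ (nu_atom (h e) hW)
      intro x
      simp only [Set.mem_preimage, Set.mem_ofPred_eq, Function.update_self,
        Function.update_of_ne hne.symm, Set.mem_singleton_iff]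
      tauto
  · exact (measurable_measure_prodMk_right (measurable_upd e hmeas)).aemeasurable

/-- One step of the exploration, for a general finite family of weights. -/
lemma one_step {h : ι → ℝ} (hh : ∀ i, 0 ≤ h i ∧ h i ≤ 1) (J : Finset ι)
    {f : (ι → ℝ≥0∞) → ℂ} (hf : Measurable f) {B : ℝ} (hB : ∀ W, ‖f W‖ ≤ B)
    (hf0 : ∀ W, (∀ i ∈ J, W i = ⊤) → f W = 0)
    (g : ι → (ι → ℝ≥0∞) → ℂ)
    (hg : ∀ e ∈ J, ∀ x : ℝ, 0 < x → ∀ W' : ι → ℝ≥0∞, (∀ i, 0 < W' i) →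
      f (Function.update (shf (J.erase e) (ENNReal.ofReal x) W') e (ENNReal.ofReal x)) = g e W') :
    (∀ e ∈ J, IntegrableOn (fun x : ℝ => ((h e * Real.exp (-x) * ∏ i ∈ J.erase e, qf (h i) x : ℝ) : ℂ) *
        ∫ W, g e W ∂(piNu (hsx (J.erase e) x h))) (Set.Ioi 0)) ∧
    ∫ W, f W ∂(piNu h) = ∑ e ∈ J, ∫ x in Set.Ioi (0 : ℝ),
      ((h e * Real.exp (-x) * ∏ i ∈ J.erase e, qf (h i) x : ℝ) : ℂ) *
        ∫ W, g e W ∂(piNu (hsx (J.erase e) x h)) := by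
  haveI : ∀ i, IsProbabilityMeasure (nu (h i)) := fun i => nu_prob (hh i).1 (hh i).2
  let A : ι → Set (ι → ℝ≥0∞) := fun e => {W | W e ≠ ⊤ ∧ ∀ i ∈ J.erase e, W e < W i}
  have hA : ∀ e, MeasurableSet (A e) := by
    intro e
    have : A e = {W | W e = ⊤}ᶜ ∩ ⋂ i ∈ J.erase e, {W | W e < W i} := by
      ext W; simp [A]
    rw [this]
    refine (measurableSet_eq_fun (by fun_prop) (by fun_prop)).compl.inter ?_
    exact Finset.measurableSet_biInter _ fun i _ => measurableSet_lt (by fun_prop) (by fun_prop)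
  have hint : Integrable f (piNu h) :=
    Integrable.of_bound hf.aestronglyMeasurable B (ae_of_all _ hB)
  have hae : f =ᵐ[piNu h] fun W => ∑ e ∈ J, (A e).indicator f W := by
    have hne : ∀ᵐ W ∂(piNu h), ∀ e e' : ι, e ≠ e' → W e = W e' → W e = ⊤ := by
      rw [ae_all_iff]; intro e
      rw [ae_all_iff]; intro e'
      by_cases hee : e = e'
      · simp [hee]
      · filter_upwards [ae_ne hh hee] with W hW _ using hW
    filter_upwards [hne] with W hW
    by_cases hall : ∀ i ∈ J, W i = ⊤
    · rw [hf0 W hall]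
      symm
      refine Finset.sum_eq_zero fun e he => ?_
      rw [Set.indicator_of_notMem]
      exact fun h' => h'.1 (hall e he)
    · push Not at hall
      obtain ⟨i0, hi0, hi0'⟩ := hall
      obtain ⟨e, he, hmin⟩ := Finset.exists_min_image J W ⟨i0, hi0⟩
      have het : W e ≠ ⊤ := fun h' => hi0' (top_le_iff.1 (h' ▸ hmin i0 hi0))
      have hlt : ∀ i ∈ J.erase e, W e < W i := by
        intro i hi
        refine lt_of_le_of_ne (hmin i (Finset.mem_of_mem_erase hi)) fun h' => het ?_
        exact hW e i (Finset.ne_of_mem_erase hi).symm h'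
      rw [Finset.sum_eq_single e]
      · rw [Set.indicator_of_mem]; exact ⟨het, hlt⟩
      · intro b hb hbe
        rw [Set.indicator_of_notMem]
        intro h'
        exact lt_asymm (h'.2 e (Finset.mem_erase.2 ⟨hbe.symm, he⟩)) (hlt b (Finset.mem_erase.2 ⟨hbe, hb⟩))
      · intro h'; exact absurd he h'
  have hmain : ∀ e ∈ J, IntegrableOn (fun x : ℝ => ((h e * Real.exp (-x) * ∏ i ∈ J.erase e, qf (h i) x : ℝ) : ℂ) *
        ∫ W, g e W ∂(piNu (hsx (J.erase e) x h))) (Set.Ioi 0) ∧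
      ∫ W, (A e).indicator f W ∂(piNu h) = ∫ x in Set.Ioi (0 : ℝ),
      ((h e * Real.exp (-x) * ∏ i ∈ J.erase e, qf (h i) x : ℝ) : ℂ) *
        ∫ W, g e W ∂(piNu (hsx (J.erase e) x h)) := by
    intro e he
    have hfm : Measurable ((A e).indicator f) := hf.indicator (hA e)
    let F : ℝ≥0∞ × (ι → ℝ≥0∞) → ℂ := fun q => (A e).indicator f (Function.update q.2 e q.1)
    have hF : Measurable F := hfm.comp (measurable_upd e)
    have hFint : Integrable F ((nu (h e)).prod (piNu h)) := by
      refine Integrable.of_bound hF.aestronglyMeasurable B (ae_of_all _ fun q => ?_)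
      refine (norm_indicator_le_norm_self _ _).trans (hB _)
    have e1 : ∫ W, (A e).indicator f W ∂(piNu h) = ∫ x, ∫ W, F (x, W) ∂(piNu h) ∂(nu (h e)) := by
      conv_lhs => rw [← upd_map hh e]
      rw [integral_map (measurable_upd e).aemeasurable hfm.aestronglyMeasurable]
      rw [← integral_prod F hFint]
    have hφi := hFint.integral_prod_left
    have hφm : StronglyMeasurable (fun x => ∫ W, F (x, W) ∂(piNu h)) :=
      hF.stronglyMeasurable.integral_prod_right
    have hφt : (fun x => ∫ W, F (x, W) ∂(piNu h)) ⊤ = 0 := by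
      simp only
      rw [← integral_zero (ι → ℝ≥0∞) ℂ (μ := piNu h)]
      congr 1
      ext W
      simp only [F]
      rw [Set.indicator_of_notMem]
      intro h'
      exact h'.1 (by simp)
    obtain ⟨i1, i2⟩ := integral_nu (hh e).1 hφi hφm hφt
    have key : ∀ x : ℝ, 0 < x → ∫ W, F (ENNReal.ofReal x, W) ∂(piNu h) =
        ((∏ i ∈ J.erase e, qf (h i) x : ℝ) : ℂ) * ∫ W, g e W ∂(piNu (hsx (J.erase e) x h)) := by
      intro x hx
      have hset : MeasurableSet {W : ι → ℝ≥0∞ | ∀ i ∈ J.erase e, ENNReal.ofReal x < W i} := by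
        have : {W : ι → ℝ≥0∞ | ∀ i ∈ J.erase e, ENNReal.ofReal x < W i} =
            ⋂ i ∈ J.erase e, {W | ENNReal.ofReal x < W i} := by ext W; simp
        rw [this]
        exact Finset.measurableSet_biInter _ fun i _ => measurableSet_lt (by fun_prop) (by fun_prop)
      have hcomp : Measurable fun W : ι → ℝ≥0∞ => f (Function.update W e (ENNReal.ofReal x)) :=
        hf.comp ((measurable_upd e).comp (measurable_const.prodMk measurable_id))
      have e2 : ∀ W, F (ENNReal.ofReal x, W) =
          {W : ι → ℝ≥0∞ | ∀ i ∈ J.erase e, ENNReal.ofReal x < W i}.indicator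
            (fun W => f (Function.update W e (ENNReal.ofReal x))) W := by
        intro W
        have hiff : Function.update W e (ENNReal.ofReal x) ∈ A e ↔
            W ∈ {W : ι → ℝ≥0∞ | ∀ i ∈ J.erase e, ENNReal.ofReal x < W i} := by
          simp only [A, Set.mem_ofPred_eq, Function.update_self]
          constructor
          · rintro ⟨-, h2⟩ i hi
            have := h2 i hi
            rwa [Function.update_of_ne (Finset.ne_of_mem_erase hi)] at this
          · intro h2
            refine ⟨ENNReal.ofReal_ne_top, fun i hi => ?_⟩
            rw [Function.update_of_ne (Finset.ne_of_mem_erase hi)]; exact h2 i hi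
        simp only [F, Set.indicator, hiff]
      simp_rw [e2]
      rw [integral_indicator hset, pi_restrict hh _ hx.le, integral_smul_measure,
        integral_map (measurable_shf _ _).aemeasurable hcomp.aestronglyMeasurable,
        ENNReal.toReal_ofReal (Finset.prod_nonneg fun i _ => (qf_pos (hh i).1 (hh i).2).le),
        Complex.real_smul]
      congr 1
      refine integral_congr_ae ?_
      filter_upwards [ae_pos (hsx (J.erase e) x h)] with W hW
      exact hg e he x hx W hW
    constructor
    · refine i2.congr_fun (fun x hx => ?_) measurableSet_Ioi
      beta_reduce; rw [key x hx]; push_cast; ring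
    · rw [e1, i1]
      refine setIntegral_congr_fun measurableSet_Ioi fun x hx => ?_
      rw [key x hx]; push_cast; ring
  refine ⟨fun e he => (hmain e he).1, ?_⟩
  rw [integral_congr_ae hae, integral_finsetSum _ fun e _ => hint.indicator (hA e)]
  exact Finset.sum_congr rfl fun e he => (hmain e he).2

end onestep

section gstep
variable {V : Type*} [Fintype V] [DecidableEq V]

/-- admissible exploration states -/
structure St (p : ℝ) (D : Finset V) (η : V → ℝ) (h : Sym2 V → ℝ) : Prop where
  hh : ∀ e, 0 ≤ h e ∧ h e ≤ 1
  hb : ∀ u ∈ D, ∀ v ∉ D, h s(u, v) = η u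
  hp : ∀ a ∉ D, ∀ b ∉ D, a ≠ b → h s(a, b) = p
  he : ∀ u ∈ D, 0 < η u ∧ η u ≤ p

def FF (z : ℂ) (D : Finset V) (d : V → ℕ) (y : V) (h : Sym2 V → ℝ) : ℂ :=
  ∫ W, Phi z D d y W ∂(piNu h)

def QQ (D : Finset V) (η : V → ℝ) (k : ℕ) (x : ℝ) : ℝ := ∏ u ∈ D, qf (η u) x ^ k

lemma hs_pos {h x : ℝ} (h0 : 0 < h) (h1 : h ≤ 1) : 0 < hs h x :=
  div_pos (mul_pos h0 (Real.exp_pos _)) (qf_pos h0.le h1)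

lemma hs_le {h x : ℝ} (h0 : 0 < h) (h1 : h ≤ 1) (hx : 0 ≤ x) : hs h x ≤ h := by
  unfold hs
  rw [div_le_iff₀ (qf_pos h0.le h1)]
  have : Real.exp (-x) ≤ 1 := Real.exp_le_one_iff.2 (by linarith)
  refine mul_le_mul_of_nonneg_left ?_ h0.le
  unfold qf
  nlinarith

lemma edge_inj {D : Finset V} : Set.InjOn (fun q : V × V => s(q.1, q.2))
    {q : V × V | q.1 ∈ D ∧ q.2 ∉ D} := by
  rintro ⟨a, b⟩ ⟨ha, hb⟩ ⟨c, e⟩ ⟨hc, he⟩ h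
  simp only [Sym2.eq_iff] at h
  rcases h with ⟨rfl, rfl⟩ | ⟨rfl, rfl⟩
  · rfl
  · exact absurd ha he

lemma F_step {p : ℝ} (hp1 : p ≤ 1) {D : Finset V} {η : V → ℝ} {h : Sym2 V → ℝ} (hs' : St p D η h)
    (hp0 : 0 < p)
    {z : ℂ} (hz : ‖z‖ = 1) (d : V → ℕ) {τ : V} (hτ : τ ∉ D) :
    ∃ X : V → V → ℝ → ℂ,
      (∀ u ∈ D, ∀ v ∈ Dᶜ, IntegrableOn (fun x : ℝ =>
        ((QQ D η (Dᶜ).card x * hs (η u) x : ℝ) : ℂ) * X u v x) (Set.Ioi 0)) ∧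
      FF z D d τ h = ∑ u ∈ D, ∑ v ∈ Dᶜ, ∫ x in Set.Ioi (0 : ℝ),
        ((QQ D η (Dᶜ).card x * hs (η u) x : ℝ) : ℂ) * X u v x ∧
      (∀ u ∈ D, ∀ x, 0 < x → X u τ x = z ^ (d u + 1)) ∧
      (∀ u ∈ D, ∀ v ∉ D, v ≠ τ → ∀ x, 0 < x → ∃ h',
        St p (insert v D) (fun a => if a = v then p else hs (η a) x) h' ∧
        X u v x = FF z (insert v D) (Function.update d v (d u + 1)) τ h') := by
  classical
  let em : V × V → Sym2 V := fun q => s(q.1, q.2)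
  have hinj : Set.InjOn em {q : V × V | q.1 ∈ D ∧ q.2 ∉ D} := edge_inj
  have hinj' : Set.InjOn em ((D ×ˢ Dᶜ : Finset (V × V)) : Set (V × V)) := by
    refine hinj.mono fun q hq => ?_
    simpa using hq
  let J : Finset (Sym2 V) := (D ×ˢ Dᶜ).image em
  have hJ : ∀ a b, a ∈ D → b ∉ D → s(a, b) ∈ J := fun a b ha hb =>
    Finset.mem_image.2 ⟨(a, b), by simp [ha, hb], rfl⟩
  have hJ' : ∀ e ∈ J, ∃ a b, a ∈ D ∧ b ∉ D ∧ e = s(a, b) := by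
    intro e he
    obtain ⟨⟨a, b⟩, hq, rfl⟩ := Finset.mem_image.1 he
    simp at hq
    exact ⟨a, b, hq.1, hq.2, rfl⟩
  haveI : Nonempty V := ⟨τ⟩
  let uv : Sym2 V → V × V := Function.invFunOn em {q : V × V | q.1 ∈ D ∧ q.2 ∉ D}
  have huv : ∀ a b, a ∈ D → b ∉ D → uv s(a, b) = (a, b) := fun a b ha hb =>
    hinj.leftInvOn_invFunOn (show (a, b) ∈ {q : V × V | q.1 ∈ D ∧ q.2 ∉ D} from ⟨ha, hb⟩)
  let G : V → V → (Sym2 V → ℝ≥0∞) → ℂ := fun u v W =>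
    if v = τ then z ^ (d u + 1) else Phi z (insert v D) (Function.update d v (d u + 1)) τ W
  have hnotJ : ∀ a ∉ D, ∀ b ∉ D, s(a, b) ∉ J := by
    intro a ha b hb hmem
    obtain ⟨a', b', ha', hb', h'⟩ := hJ' _ hmem
    rw [Sym2.eq_iff] at h'
    rcases h' with ⟨rfl, rfl⟩ | ⟨rfl, rfl⟩
    · exact ha ha'
    · exact hb ha'
  have hne : ∀ a b u v, a ∈ D → b ∉ D → u ∈ D → v ∉ D → (a ≠ u ∨ b ≠ v) → s(a, b) ≠ s(u, v) := by
    intro a b u v ha hb hu hv hab h'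
    have := hinj (show (a, b) ∈ _ from ⟨ha, hb⟩) (show (u, v) ∈ _ from ⟨hu, hv⟩) h'
    simp at this
    tauto
  have key := one_step hs'.hh J (measurable_Phi D d τ z) (norm_Phi_le D d τ hz)
    (fun W hW => phi_top z (fun a ha b hb => hW _ (hJ a b ha hb)) hτ)
    (fun e => G (uv e).1 (uv e).2) (by
      intro e he x hx W' hW'
      obtain ⟨u, v, hu, hv, rfl⟩ := hJ' e he
      rw [huv u v hu hv]
      have hx0 : (0 : ℝ≥0∞) < ENNReal.ofReal x := ENNReal.ofReal_pos.2 hx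
      have hx1 : ENNReal.ofReal x ≠ ⊤ := ENNReal.ofReal_ne_top
      set W := Function.update (shf (J.erase s(u, v)) (ENNReal.ofReal x) W') s(u, v) (ENNReal.ofReal x) with hW
      have h1 : W s(u, v) = ENNReal.ofReal x := by simp [hW]
      have h2 : ∀ a ∈ D, ∀ b ∉ D, (a ≠ u ∨ b ≠ v) → W s(a, b) = W' s(a, b) + ENNReal.ofReal x := by
        intro a ha b hb hab
        have hne' := hne a b u v ha hb hu hv hab
        rw [hW, Function.update_of_ne hne', shf, if_pos (Finset.mem_erase.2 ⟨hne', hJ a b ha hb⟩)]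
      have h3 : ∀ a ∉ D, ∀ b ∉ D, W s(a, b) = W' s(a, b) := by
        intro a ha b hb
        have hn := hnotJ a ha b hb
        have : s(a, b) ≠ s(u, v) := fun h' => hn (h' ▸ hJ u v hu hv)
        rw [hW, Function.update_of_ne this, shf, if_neg (fun h' => hn (Finset.mem_of_mem_erase h'))]
      have hpos : ∀ e, 0 < W e := by
        intro e
        by_cases hee : e = s(u, v)
        · rw [hee, h1]; exact hx0
        · rw [hW, Function.update_of_ne hee, shf]
          split_ifs
          · exact lt_of_lt_of_le (hW' e) le_self_add
          · exact hW' e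
      by_cases hvτ : v = τ
      · simp only [G, hvτ, if_true]
        subst hvτ
        exact phi_hit z hu hv hx0 hx1 h1 (fun a ha b hb hab => by
          rw [h2 a ha b hb hab, add_comm]
          exact ENNReal.lt_add_right hx1 (hW' _).ne') hpos
      · simp only [G, hvτ, if_false]
        exact phi_step z hu hv hx0 hx1 h1 h2 h3 hpos hW' hτ (Ne.symm hvτ))
  have hw : ∀ u ∈ D, ∀ v ∉ D, ∀ x : ℝ, h s(u, v) * Real.exp (-x) * ∏ i ∈ J.erase s(u, v), qf (h i) x
      = QQ D η (Dᶜ).card x * hs (η u) x := by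
    intro u hu v hv x
    have e1 : ∏ i ∈ J, qf (h i) x = QQ D η (Dᶜ).card x := by
      rw [Finset.prod_image hinj', Finset.prod_product]
      refine Finset.prod_congr rfl fun a ha => ?_
      rw [Finset.prod_congr rfl (g := fun _ => qf (η a) x), Finset.prod_const]
      intro b hb
      simp only [em]
      rw [hs'.hb a ha b (by simpa using hb)]
    have e2 := Finset.mul_prod_erase J (fun i => qf (h i) x) (hJ u v hu hv)
    rw [e1, hs'.hb u hu v hv] at e2
    have hq : 0 < qf (η u) x := qf_pos (hs'.he u hu).1.le ((hs'.he u hu).2.trans hp1)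
    rw [← e2, hs'.hb u hu v hv]
    unfold hs
    field_simp
  refine ⟨fun u v x => ∫ W, G u v W ∂(piNu (hsx (J.erase s(u, v)) x h)), ?_, ?_, ?_, ?_⟩
  · intro u hu v hv
    have hv' : v ∉ D := by simpa using hv
    have := key.1 s(u, v) (hJ u v hu hv')
    rw [huv u v hu hv'] at this
    simpa only [hw u hu v hv'] using this
  · rw [FF, key.2, Finset.sum_image hinj', Finset.sum_product]
    refine Finset.sum_congr rfl fun u hu => Finset.sum_congr rfl fun v hv => ?_
    have hv' : v ∉ D := by simpa using hv
    simp only [em, huv u v hu hv', hw u hu v hv']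
  · intro u hu x hx
    simp only [G, if_true]
    haveI : ∀ i, IsProbabilityMeasure (nu (hsx (J.erase s(u, τ)) x h i)) := fun i =>
      nu_prob (hsx_mem hs'.hh _ _ _).1 (hsx_mem hs'.hh _ _ _).2
    simp
  · intro u hu v hv hvτ x hx
    refine ⟨hsx (J.erase s(u, v)) x h, ⟨fun e => hsx_mem hs'.hh _ _ _, ?_, ?_, ?_⟩, ?_⟩
    · intro a ha b hb
      have hbD : b ∉ D := fun h' => hb (Finset.mem_insert_of_mem h')
      have hbv : b ≠ v := fun h' => hb (by simp [h'])
      by_cases hav : a = v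
      · subst hav
        rw [if_pos rfl, hsx, if_neg (fun h' => hnotJ a hv b hbD (Finset.mem_of_mem_erase h')),
          hs'.hp a hv b hbD hbv.symm]
      · have haD : a ∈ D := (Finset.mem_insert.1 ha).resolve_left hav
        rw [if_neg hav, hsx, if_pos, hs'.hb a haD b hbD]
        exact Finset.mem_erase.2 ⟨hne a b u v haD hbD hu hv (Or.inr hbv), hJ a b haD hbD⟩
    · intro a ha b hb hab
      have haD : a ∉ D := fun h' => ha (Finset.mem_insert_of_mem h')
      have hbD : b ∉ D := fun h' => hb (Finset.mem_insert_of_mem h')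
      rw [hsx, if_neg (fun h' => hnotJ a haD b hbD (Finset.mem_of_mem_erase h')), hs'.hp a haD b hbD hab]
    · intro a ha
      by_cases hav : a = v
      · simp [hav, hp0]
      · have haD : a ∈ D := (Finset.mem_insert.1 ha).resolve_left hav
        obtain ⟨q1, q2⟩ := hs'.he a haD
        simp only [if_neg hav]
        exact ⟨hs_pos q1 (q2.trans hp1), (hs_le q1 (q2.trans hp1) hx.le).trans q2⟩
    · simp only [G, if_neg hvτ, FF]

lemma FF_norm {D : Finset V} {h : Sym2 V → ℝ} (hh : ∀ e, 0 ≤ h e ∧ h e ≤ 1)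
    {z : ℂ} (hz : ‖z‖ = 1) (d : V → ℕ) (τ : V) : ‖FF z D d τ h‖ ≤ 1 := by
  haveI : ∀ i, IsProbabilityMeasure (nu (h i)) := fun i => nu_prob (hh i).1 (hh i).2
  have := norm_integral_le_of_norm_le_const (μ := piNu h) (C := 1)
    (ae_of_all _ (norm_Phi_le D d τ hz))
  simpa [FF] using this

end gstep

section moments
variable {V : Type*}

def EE (D : Finset V) (η : V → ℝ) (k : ℕ) (x : ℝ) : ℝ := -(k * ∑ u ∈ D, Real.log (qf (η u) x))
def SS (D : Finset V) (η : V → ℝ) (x : ℝ) : ℝ := ∑ u ∈ D, hs (η u) x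
def rho (D : Finset V) (η : V → ℝ) (k : ℕ) (x : ℝ) : ℝ := QQ D η k x * (k * SS D η x)

variable {D : Finset V} {η : V → ℝ} {k : ℕ}

lemma qf_le_one {h x : ℝ} (h0 : 0 ≤ h) (hx : 0 ≤ x) : qf h x ≤ 1 := by
  have : Real.exp (-x) ≤ 1 := Real.exp_le_one_iff.2 (by linarith)
  unfold qf; nlinarith

lemma QQ_eq (hη : ∀ u ∈ D, 0 < η u ∧ η u ≤ 1) (x : ℝ) : QQ D η k x = Real.exp (-EE D η k x) := by
  unfold QQ EE
  rw [neg_neg, Finset.mul_sum, Real.exp_sum]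
  refine Finset.prod_congr rfl fun u hu => ?_
  rw [Real.exp_nat_mul, Real.exp_log (qf_pos (hη u hu).1.le (hη u hu).2)]

lemma EE_nonneg (hη : ∀ u ∈ D, 0 < η u ∧ η u ≤ 1) {x : ℝ} (hx : 0 ≤ x) : 0 ≤ EE D η k x := by
  unfold EE
  have : ∑ u ∈ D, Real.log (qf (η u) x) ≤ 0 := Finset.sum_nonpos fun u hu =>
    Real.log_nonpos (qf_pos (hη u hu).1.le (hη u hu).2).le (qf_le_one (hη u hu).1.le hx)
  nlinarith [(Nat.cast_nonneg k : (0:ℝ) ≤ k)]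

lemma EE_deriv (hη : ∀ u ∈ D, 0 < η u ∧ η u ≤ 1) (x : ℝ) :
    HasDerivAt (EE D η k) (k * SS D η x) x := by
  have h1 : ∀ u ∈ D, HasDerivAt (fun x => Real.log (qf (η u) x)) (-(hs (η u) x)) x := by
    intro u hu
    have h2 : HasDerivAt (fun x => qf (η u) x) (η u * (Real.exp (-x) * (-1))) x := by
      unfold qf
      exact (((hasDerivAt_id x).neg.exp).const_mul _).const_add _
    have := h2.log (qf_pos (hη u hu).1.le (hη u hu).2).ne'
    convert this using 1
    unfold hs; ring
  have h2 := ((HasDerivAt.fun_sum h1).const_mul (k : ℝ)).neg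
  refine HasDerivAt.congr_deriv (f := EE D η k) h2 ?_
  unfold SS; rw [Finset.sum_neg_distrib]; ring

lemma SS_nonneg (hη : ∀ u ∈ D, 0 < η u ∧ η u ≤ 1) (x : ℝ) : 0 ≤ SS D η x :=
  Finset.sum_nonneg fun u hu => hs_nonneg (hη u hu).1.le (hη u hu).2

lemma rho_nonneg (hη : ∀ u ∈ D, 0 < η u ∧ η u ≤ 1) (x : ℝ) : 0 ≤ rho D η k x := by
  unfold rho
  rw [QQ_eq hη]
  have := SS_nonneg hη x
  positivity

lemma QQ_tendsto : Tendsto (QQ D η k) atTop (nhds (∏ u ∈ D, (1 - η u) ^ k)) := by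
  unfold QQ
  refine tendsto_finsetProd _ fun u _ => Tendsto.pow ?_ k
  unfold qf
  have : Tendsto (fun x : ℝ => Real.exp (-x)) atTop (nhds 0) := Real.tendsto_exp_neg_atTop_nhds_zero
  simpa using (this.const_mul (η u)).const_add (1 - η u)

lemma moments (hη : ∀ u ∈ D, 0 < η u ∧ η u ≤ 1) :
    ∃ q : ℝ, 0 ≤ q ∧ q ≤ Real.exp (-(k * ∑ u ∈ D, η u)) ∧
      IntegrableOn (rho D η k) (Set.Ioi 0) ∧
      IntegrableOn (fun x => rho D η k x * EE D η k x) (Set.Ioi 0) ∧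
      IntegrableOn (fun x => rho D η k x * Real.exp (EE D η k x / 2)) (Set.Ioi 0) ∧
      ∫ x in Set.Ioi 0, rho D η k x = 1 - q ∧
      ∫ x in Set.Ioi 0, rho D η k x * EE D η k x = 1 - q + q * Real.log q ∧
      ∫ x in Set.Ioi 0, rho D η k x * Real.exp (EE D η k x / 2) ≤ 2 := by
  set q := ∏ u ∈ D, (1 - η u) ^ k with hq
  have hE0 : EE D η k 0 = 0 := by simp [EE, qf]
  have hr := rho_nonneg (k := k) hη
  have hrho : ∀ x, rho D η k x = Real.exp (-EE D η k x) * (k * SS D η x) := fun x => by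
    rw [rho, QQ_eq hη]
  have hT := QQ_tendsto (D := D) (η := η) (k := k)
  have hlog : ∀ x, Real.log (QQ D η k x) = -EE D η k x := fun x => by rw [QQ_eq hη, Real.log_exp]
  -- antiderivatives
  have d0 : ∀ x ∈ Set.Ici (0:ℝ), HasDerivAt (fun x => -QQ D η k x) (rho D η k x) x := by
    intro x _
    have := ((EE_deriv (k := k) hη x).neg.exp).neg
    rw [show (fun x => -QQ D η k x) = fun x => -Real.exp (-EE D η k x) from
      funext fun x => by rw [QQ_eq hη]]
    refine HasDerivAt.congr_deriv this ?_
    rw [hrho, Pi.neg_apply]; ring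
  have d1 : ∀ x ∈ Set.Ici (0:ℝ), HasDerivAt (fun x => -QQ D η k x + QQ D η k x * Real.log (QQ D η k x))
      (rho D η k x * EE D η k x) x := by
    intro x _
    have h1 := EE_deriv (k := k) hη x
    have h2 := h1.neg.exp
    have := h2.neg.add (h2.mul h1.neg)
    rw [show (fun x => -QQ D η k x + QQ D η k x * Real.log (QQ D η k x)) =
      fun x => -Real.exp (-EE D η k x) + Real.exp (-EE D η k x) * (-EE D η k x) from
      funext fun x => by rw [hlog, QQ_eq hη]]
    refine HasDerivAt.congr_deriv this ?_
    rw [hrho]; simp only [Pi.neg_apply]; ring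
  have d2 : ∀ x ∈ Set.Ici (0:ℝ), HasDerivAt (fun x => -2 * Real.sqrt (QQ D η k x))
      (rho D η k x * Real.exp (EE D η k x / 2)) x := by
    intro x _
    have h1 := (EE_deriv (k := k) hη x).neg.div_const 2
    have := h1.exp.const_mul (-2)
    rw [show (fun x => -2 * Real.sqrt (QQ D η k x)) = fun x => -2 * Real.exp (-EE D η k x / 2) from
      funext fun x => by rw [QQ_eq hη, Real.exp_half]]
    refine HasDerivAt.congr_deriv this ?_
    rw [hrho]
    simp only [Pi.neg_apply]
    have : Real.exp (-EE D η k x / 2) = Real.exp (-EE D η k x) * Real.exp (EE D η k x / 2) := by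
      rw [← Real.exp_add]; ring_nf
    rw [this]; ring
  have t0 : Tendsto (fun x => -QQ D η k x) atTop (nhds (-q)) := hT.neg
  have t1 : Tendsto (fun x => -QQ D η k x + QQ D η k x * Real.log (QQ D η k x)) atTop
      (nhds (-q + q * Real.log q)) := t0.add ((Real.continuous_mul_log.tendsto q).comp hT)
  have t2 : Tendsto (fun x => -2 * Real.sqrt (QQ D η k x)) atTop (nhds (-2 * Real.sqrt q)) :=
    ((Real.continuous_sqrt.tendsto q).comp hT).const_mul _
  have p1 : ∀ x ∈ Set.Ioi (0:ℝ), 0 ≤ rho D η k x * EE D η k x := fun x hx =>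
    mul_nonneg (hr x) (EE_nonneg hη (le_of_lt hx))
  have p2 : ∀ x ∈ Set.Ioi (0:ℝ), 0 ≤ rho D η k x * Real.exp (EE D η k x / 2) := fun x hx =>
    mul_nonneg (hr x) (Real.exp_pos _).le
  have hQ0 : QQ D η k 0 = 1 := by rw [QQ_eq hη, hE0]; simp
  refine ⟨q, ?_, ?_, integrableOn_Ioi_deriv_of_nonneg' d0 (fun x _ => hr x) t0,
    integrableOn_Ioi_deriv_of_nonneg' d1 p1 t1, integrableOn_Ioi_deriv_of_nonneg' d2 p2 t2, ?_, ?_, ?_⟩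
  · exact Finset.prod_nonneg fun u hu => pow_nonneg (by linarith [(hη u hu).2]) _
  · rw [hq, Finset.mul_sum, ← Finset.sum_neg_distrib, Real.exp_sum]
    refine Finset.prod_le_prod (fun u hu => pow_nonneg (by linarith [(hη u hu).2]) _) fun u hu => ?_
    rw [← mul_neg, Real.exp_nat_mul]
    refine pow_le_pow_left₀ (by linarith [(hη u hu).2]) ?_ k
    have := Real.add_one_le_exp (-η u); linarith
  · rw [integral_Ioi_of_hasDerivAt_of_nonneg' d0 (fun x _ => hr x) t0, hQ0]; ring
  · rw [integral_Ioi_of_hasDerivAt_of_nonneg' d1 p1 t1, hQ0]; simp; ring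
  · rw [integral_Ioi_of_hasDerivAt_of_nonneg' d2 p2 t2, hQ0]
    have := Real.sqrt_nonneg q
    simp

/-- loss of hazard along time `x` -/
lemma hs_diff {h x : ℝ} (h0 : 0 < h) (h1 : h ≤ 1) (hx : 0 ≤ x) :
    (1 - h) * (-Real.log (qf h x)) ≤ h - hs h x ∧ h - hs h x ≤ -Real.log (qf h x) := by
  have hq := qf_pos (x := x) h0.le h1
  have hq1 := qf_le_one (x := x) h0.le hx
  have e1 : h - hs h x = (1 - h) * ((1 - qf h x) / qf h x) := by
    unfold hs
    rw [eq_comm, ← sub_eq_zero]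
    field_simp
    unfold qf; ring
  have hqh : 1 - h ≤ qf h x := by unfold qf; nlinarith [Real.exp_pos (-x)]
  have hl := Real.log_le_sub_one_of_pos hq
  have hl2 := Real.one_sub_inv_le_log_of_pos hq
  rw [e1]
  constructor
  · refine mul_le_mul_of_nonneg_left ?_ (by linarith)
    have : (1 - qf h x) / qf h x = (qf h x)⁻¹ - 1 := by field_simp
    linarith
  · have : (1 - h) * ((1 - qf h x) / qf h x) ≤ qf h x * ((1 - qf h x) / qf h x) :=
      mul_le_mul_of_nonneg_right hqh (div_nonneg (by linarith) hq.le)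
    rw [mul_div_cancel₀ _ hq.ne'] at this
    linarith

lemma SS_diff {p : ℝ} (hp1 : p ≤ 1) (hη : ∀ u ∈ D, 0 < η u ∧ η u ≤ p) (hk : 0 < k)
    {x : ℝ} (hx : 0 ≤ x) :
    (1 - p) * (EE D η k x / k) ≤ ∑ u ∈ D, η u - SS D η x ∧
    ∑ u ∈ D, η u - SS D η x ≤ EE D η k x / k := by
  have hk' : (0:ℝ) < k := by exact_mod_cast hk
  have e : EE D η k x / k = ∑ u ∈ D, -Real.log (qf (η u) x) := by
    rw [EE, Finset.sum_neg_distrib]; field_simp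
  rw [e, SS, ← Finset.sum_sub_distrib, Finset.mul_sum]
  constructor
  · refine Finset.sum_le_sum fun u hu => ?_
    obtain ⟨a, b⟩ := hη u hu
    refine le_trans ?_ (hs_diff a (b.trans hp1) hx).1
    refine mul_le_mul_of_nonneg_right (by linarith) ?_
    have := Real.log_nonpos (qf_pos (x := x) a.le (b.trans hp1)).le (qf_le_one a.le hx)
    linarith
  · exact Finset.sum_le_sum fun u hu => (hs_diff (hη u hu).1 ((hη u hu).2.trans hp1) hx).2

/-- averages move slowly -/
lemma r_diff {p : ℝ} (hp1 : p ≤ 1) (hη : ∀ u ∈ D, 0 < η u ∧ η u ≤ p) (hk : 0 < k)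
    (hD : D.Nonempty) {x : ℝ} (hx : 0 ≤ x) (c : V → ℂ) (hc : ∀ u, ‖c u‖ ≤ 1) :
    ‖(∑ u ∈ D, c u * (hs (η u) x : ℂ)) / (SS D η x : ℂ) -
      (∑ u ∈ D, c u * (η u : ℂ)) / ((∑ u ∈ D, η u : ℝ) : ℂ)‖ ≤
      2 * p * (EE D η k x / k) / SS D η x := by
  have hk' : (0:ℝ) < k := by exact_mod_cast hk
  have e : EE D η k x / k = ∑ u ∈ D, -Real.log (qf (η u) x) := by
    rw [EE, Finset.sum_neg_distrib]; field_simp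
  have hSx : 0 < SS D η x := Finset.sum_pos (fun u hu => hs_pos (hη u hu).1 ((hη u hu).2.trans hp1)) hD
  have hS : 0 < ∑ u ∈ D, η u := Finset.sum_pos (fun u hu => (hη u hu).1) hD
  set r0 : ℂ := (∑ u ∈ D, c u * (η u : ℂ)) / ((∑ u ∈ D, η u : ℝ) : ℂ) with hr0
  have hr0n : ‖r0‖ ≤ 1 := by
    rw [hr0, norm_div, Complex.norm_real, Real.norm_of_nonneg hS.le, div_le_one hS]
    refine (norm_sum_le _ _).trans (Finset.sum_le_sum fun u hu => ?_)
    rw [norm_mul, Complex.norm_real, Real.norm_of_nonneg (hη u hu).1.le]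
    exact mul_le_of_le_one_left (hη u hu).1.le (hc u)
  have hSxc : (SS D η x : ℂ) ≠ 0 := by exact_mod_cast hSx.ne'
  have hSc : ((∑ u ∈ D, η u : ℝ) : ℂ) ≠ 0 := by exact_mod_cast hS.ne'
  -- centred sum vanishes
  have hz : ∑ u ∈ D, (c u - r0) * (η u : ℂ) = 0 := by
    simp_rw [sub_mul]
    rw [Finset.sum_sub_distrib, ← Finset.mul_sum, hr0]
    push_cast
    push_cast at hSc
    rw [div_mul_cancel₀ _ hSc, sub_self]
  have hrep : ∀ u ∈ D, (hs (η u) x : ℂ) =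
      (Real.exp (-x) : ℂ) * (η u : ℂ) + (hs (η u) x * (1 - qf (η u) x) : ℝ) := by
    intro u hu
    have hq := qf_pos (x := x) (hη u hu).1.le ((hη u hu).2.trans hp1)
    rw [← Complex.ofReal_mul, ← Complex.ofReal_add]
    congr 1
    unfold hs
    field_simp
    ring
  have e1 : (∑ u ∈ D, c u * (hs (η u) x : ℂ)) / (SS D η x : ℂ) - r0 =
      (∑ u ∈ D, (c u - r0) * ((hs (η u) x * (1 - qf (η u) x) : ℝ) : ℂ)) / (SS D η x : ℂ) := by
    rw [eq_div_iff hSxc, sub_mul, div_mul_cancel₀ _ hSxc]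
    have : ∑ u ∈ D, (c u - r0) * (hs (η u) x : ℂ) =
        ∑ u ∈ D, (c u - r0) * ((hs (η u) x * (1 - qf (η u) x) : ℝ) : ℂ) := by
      rw [← zero_add (∑ u ∈ D, (c u - r0) * ((hs (η u) x * (1 - qf (η u) x) : ℝ) : ℂ)),
        ← mul_zero (Real.exp (-x) : ℂ), ← hz, Finset.mul_sum, ← Finset.sum_add_distrib]
      refine Finset.sum_congr rfl fun u hu => ?_
      conv_lhs => rw [hrep u hu]
      ring
    rw [← this]
    simp_rw [sub_mul]
    rw [Finset.sum_sub_distrib, ← Finset.mul_sum]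
    unfold SS; push_cast; ring
  rw [e1, norm_div, Complex.norm_real, Real.norm_of_nonneg hSx.le, e, Finset.mul_sum]
  refine div_le_div_of_nonneg_right ?_ hSx.le
  refine (norm_sum_le _ _).trans (Finset.sum_le_sum fun u hu => ?_)
  obtain ⟨a, b⟩ := hη u hu
  have hq := qf_pos (x := x) a.le (b.trans hp1)
  have hq1 := qf_le_one (x := x) a.le hx
  have hl := Real.log_le_sub_one_of_pos hq
  have hh0 := hs_nonneg (x := x) a.le (b.trans hp1)
  have hh1 := (hs_le a (b.trans hp1) hx).trans b
  rw [norm_mul, Complex.norm_real, Real.norm_of_nonneg (mul_nonneg hh0 (by linarith))]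
  have h2 : ‖c u - r0‖ ≤ 2 := (norm_sub_le _ _).trans (by linarith [hc u])
  calc ‖c u - r0‖ * (hs (η u) x * (1 - qf (η u) x)) ≤ 2 * (p * (-Real.log (qf (η u) x))) := by
        refine mul_le_mul h2 ?_ (mul_nonneg hh0 (by linarith)) (by norm_num)
        exact mul_le_mul hh1 (by linarith) (by linarith) (by linarith)
    _ = _ := by ring

end moments

section scalar

lemma log_bd {δ : ℝ} (h : -(1/2) ≤ δ) :
    |Real.log (1 + δ) - δ| ≤ 2 * δ ^ 2 ∧ |Real.log (1 + δ)| ≤ 2 * |δ| := by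
  have hp : 0 < 1 + δ := by linarith
  have h1 := Real.log_le_sub_one_of_pos hp
  have h2 := Real.one_sub_inv_le_log_of_pos hp
  have e : 1 - (1 + δ)⁻¹ = δ / (1 + δ) := by field_simp; ring
  rw [e] at h2
  have h3 : δ - 2 * δ ^ 2 ≤ δ / (1 + δ) := by
    rw [le_div_iff₀ hp]; nlinarith [sq_nonneg δ, mul_nonneg (sq_nonneg δ) (by linarith : 0 ≤ 1 + 2 * δ)]
  constructor
  · rw [abs_le]; constructor <;> nlinarith [sq_nonneg δ]
  · rcases le_total 0 δ with h0 | h0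
    · rw [abs_of_nonneg h0, abs_le]
      have : 0 ≤ δ / (1 + δ) := by positivity
      constructor <;> linarith
    · rw [abs_of_nonpos h0, abs_le]
      have : 2 * δ ≤ δ / (1 + δ) := by rw [le_div_iff₀ hp]; nlinarith
      constructor <;> linarith

lemma rem_bd {w : ℂ} (hw : ‖w‖ ≤ 1/8) {β y y1 δ : ℝ} (hβ0 : 0 ≤ β) (hβ : β ≤ 2) (hy : 0 < y)
    (hδ : -(1/2) ≤ δ) (hδ2 : |δ| ≤ 2) (hy1 : y1 = y * (1 + δ)) :
    ‖(1 + w / y1) * Complex.exp (-(w * β * Real.log (1 + δ))) - 1 - (w / y - w * β * δ)‖ ≤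
      ‖w‖ * (6 * δ ^ 2 + 4 * |δ| / y) := by
  obtain ⟨l1, l2⟩ := log_bd hδ
  have hp : 0 < 1 + δ := by linarith
  have hy1p : 0 < y1 := by rw [hy1]; positivity
  set u : ℂ := -(w * β * Real.log (1 + δ)) with hu
  have hun : ‖u‖ ≤ 4 * ‖w‖ * |δ| := by
    rw [hu, norm_neg, norm_mul, norm_mul, Complex.norm_real, Complex.norm_real,
      Real.norm_of_nonneg hβ0, Real.norm_eq_abs]
    calc ‖w‖ * β * |Real.log (1 + δ)| ≤ ‖w‖ * 2 * (2 * |δ|) := by gcongr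
      _ = _ := by ring
  have hw0 := norm_nonneg w
  have hd0 := abs_nonneg δ
  have hu1 : ‖u‖ ≤ 1 := hun.trans (by nlinarith)
  have b1 : ‖Complex.exp u - 1 - u‖ ≤ 2 * ‖w‖ * δ ^ 2 := by
    refine (Complex.norm_exp_sub_one_sub_id_le hu1).trans ?_
    have : ‖u‖ ^ 2 ≤ (4 * ‖w‖ * |δ|) ^ 2 := by gcongr
    refine this.trans ?_
    rw [mul_pow, sq_abs]
    have : (4 * ‖w‖) ^ 2 ≤ 2 * ‖w‖ := by nlinarith
    gcongr
  have b2 : ‖u + w * β * δ‖ ≤ 4 * ‖w‖ * δ ^ 2 := by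
    have : u + w * β * δ = w * β * ((-(Real.log (1 + δ) - δ) : ℝ) : ℂ) := by
      rw [hu]; push_cast; ring
    rw [this, norm_mul, norm_mul, Complex.norm_real, Complex.norm_real, norm_neg,
      Real.norm_of_nonneg hβ0, Real.norm_eq_abs]
    calc ‖w‖ * β * |Real.log (1 + δ) - δ| ≤ ‖w‖ * 2 * (2 * δ ^ 2) := by gcongr
      _ = _ := by ring
  have hinv : 1 / y1 ≤ 2 / y := by
    rw [hy1, div_le_div_iff₀ (by positivity) hy]; nlinarith
  have b3 : ‖w / y1 * (Complex.exp u - 1)‖ ≤ 2 * ‖w‖ * |δ| / y := by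
    rw [norm_mul, norm_div, Complex.norm_real, Real.norm_of_nonneg hy1p.le]
    have h1 := Complex.norm_exp_sub_one_le hu1
    calc ‖w‖ / y1 * ‖Complex.exp u - 1‖ = ‖w‖ * (1 / y1) * ‖Complex.exp u - 1‖ := by ring
      _ ≤ (1/8) * (2 / y) * (2 * (4 * ‖w‖ * |δ|)) := by
          gcongr
          exact h1.trans (by linarith)
      _ = _ := by ring
  have b4 : ‖w / y1 - w / y‖ ≤ 2 * ‖w‖ * |δ| / y := by
    have : w / y1 - w / y = w * ((-(δ * (1 / y1)) : ℝ) : ℂ) := by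
      have : (y : ℂ) ≠ 0 := by exact_mod_cast hy.ne'
      have h' : ((1 + δ : ℝ) : ℂ) ≠ 0 := by exact_mod_cast hp.ne'
      rw [hy1]; push_cast; push_cast at h'; field_simp; ring
    rw [this, norm_mul, Complex.norm_real, norm_neg, Real.norm_eq_abs, abs_mul,
      abs_of_pos (by positivity : 0 < 1 / y1)]
    calc ‖w‖ * (|δ| * (1 / y1)) ≤ ‖w‖ * (|δ| * (2 / y)) := by gcongr
      _ = _ := by ring
  have : (1 + w / y1) * Complex.exp u - 1 - (w / y - w * β * δ) =
      (Complex.exp u - 1 - u) + (u + w * β * δ) + w / y1 * (Complex.exp u - 1) + (w / y1 - w / y) := by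
    ring
  rw [this]
  refine (norm_add_le _ _).trans ?_
  refine (add_le_add (norm_add_le _ _) le_rfl).trans ?_
  refine (add_le_add (add_le_add (norm_add_le _ _) le_rfl) le_rfl).trans ?_
  calc _ ≤ 2 * ‖w‖ * δ ^ 2 + 4 * ‖w‖ * δ ^ 2 + 2 * ‖w‖ * |δ| / y + 2 * ‖w‖ * |δ| / y := by gcongr
    _ = _ := by ring

def psi (w : ℂ) (β N t : ℝ) : ℂ := Complex.exp (w * β * ((Real.log N - Real.log t : ℝ) : ℂ))

lemma re_nonpos {w : ℂ} (hw : ‖1 + w‖ = 1) : w.re ≤ 0 := by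
  have := Complex.abs_re_le_norm (1 + w)
  rw [hw] at this
  have := (abs_le.1 this).2
  simp at this
  linarith

lemma psi_norm {w : ℂ} (hw : ‖1 + w‖ = 1) {β N t : ℝ} (hβ : 0 ≤ β) (ht : 0 < t) (htN : t ≤ N) :
    ‖psi w β N t‖ ≤ 1 := by
  unfold psi
  rw [Complex.norm_exp, Real.exp_le_one_iff, mul_assoc, ← Complex.ofReal_mul, Complex.re_mul_ofReal]
  exact mul_nonpos_of_nonpos_of_nonneg (re_nonpos hw)
    (mul_nonneg hβ (sub_nonneg.2 (Real.log_le_log ht htN)))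

lemma psi_sub_one {w : ℂ} (hw : ‖1 + w‖ = 1) {β N t : ℝ} (hβ : 0 ≤ β) (hβ2 : β ≤ 2) (ht : 0 < t)
    (htN : t ≤ N) : ‖psi w β N t - 1‖ ≤ 4 * ‖w‖ * (Real.log N - Real.log t) := by
  have h1 := psi_norm hw hβ ht htN
  have hl := sub_nonneg.2 (Real.log_le_log ht htN)
  set u : ℂ := w * β * ((Real.log N - Real.log t : ℝ) : ℂ) with hu
  have hun : ‖u‖ ≤ 2 * ‖w‖ * (Real.log N - Real.log t) := by
    rw [hu, norm_mul, norm_mul, Complex.norm_real, Complex.norm_real, Real.norm_of_nonneg hβ,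
      Real.norm_of_nonneg hl]
    have := norm_nonneg w
    calc _ ≤ ‖w‖ * 2 * (Real.log N - Real.log t) := by gcongr
      _ = _ := by ring
  rcases le_total ‖u‖ 1 with h | h
  · have : ‖psi w β N t - 1‖ ≤ 2 * ‖u‖ := Complex.norm_exp_sub_one_le h
    linarith
  · have : ‖psi w β N t - 1‖ ≤ 2 := (norm_sub_le _ _).trans (by simp; linarith)
    linarith

lemma psi_mul {w : ℂ} {β N y δ : ℝ} (hy : 0 < y) (hδ : 0 < 1 + δ) :
    psi w β N (y * (1 + δ)) = psi w β N y * Complex.exp (-(w * β * Real.log (1 + δ))) := by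
  unfold psi
  rw [← Complex.exp_add, Real.log_mul hy.ne' hδ.ne']
  congr 1
  push_cast; ring

lemma log_sqrt {N m : ℝ} (hm : 0 < m) (hmN : m ≤ N) :
    Real.log N - Real.log (m / 4) ≤ 4 * Real.sqrt (N / m) := by
  have hN : 0 < N := by linarith
  rw [← Real.log_div hN.ne' (by positivity)]
  have e : N / (m / 4) = (2 * Real.sqrt (N / m)) ^ 2 := by
    rw [mul_pow, Real.sq_sqrt (by positivity)]; field_simp; norm_num
  rw [e, Real.log_pow]
  have : 0 < Real.sqrt (N / m) := Real.sqrt_pos.2 (by positivity)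
  have := Real.log_le_self (by positivity : 0 ≤ 2 * Real.sqrt (N / m))
  push_cast; linarith

/-- step cost -/
def cst (W N m k p : ℝ) : ℝ :=
  1 / (k * m) + W / k * Real.sqrt (N / m) + W / m ^ 2 + 1 / (k * p * m) ^ 2

end scalar

section pointwise

lemma tfacts {E : ℝ} (hE : 0 ≤ E) : 1 ≤ (1 + E) ^ 3 ∧ E ≤ (1 + E) ^ 3 ∧ (1 + E) * E ^ 2 ≤ (1 + E) ^ 3 ∧
    (1 + E) ^ 2 ≤ (1 + E) ^ 3 ∧ E ^ 2 ≤ (1 + E) ^ 3 := by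
  have := pow_nonneg hE 2
  have := pow_nonneg hE 3
  refine ⟨?_, ?_, ?_, ?_, ?_⟩ <;> ring_nf <;> linarith

set_option maxHeartbeats 4000000 in
lemma pw {w : ℂ} (hz : ‖1 + w‖ = 1) (hw : ‖w‖ ≤ 1/8) {N m k p β y yx E : ℝ} {r0 rx : ℂ}
    (hm : 1 ≤ m) (hk : 1 ≤ k) (hN : m + k = N) (hp : 0 < p) (hkp : 1 ≤ k * p)
    (hβ : β = N * p / (N * p - 1)) (hlam : 2 ≤ N * p)
    (hy0 : m / 2 ≤ y) (hym : y ≤ m) (hyx : 0 < yx) (hyxy : yx ≤ y) (hE : 0 ≤ E)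
    (hxi : y - yx ≤ E / (k * p)) (hr0 : ‖r0‖ ≤ 1) (hrx : ‖rx‖ ≤ 1)
    (hr : ‖rx - r0‖ ≤ 2 * (E / k) / yx) :
    ‖((1 + w) * rx / k + (1 - 1 / k) * (rx * (1 + w / (yx + 1 : ℝ))) * psi w β N (yx + 1))
      - r0 * psi w β N y - r0 * psi w β N y * (w / y) * β * ((y - yx - 1 / (N * p) : ℝ) : ℂ)‖ ≤
    200 * (1 + E) ^ 3 * cst ‖w‖ N m k p := by
  have hw0 := norm_nonneg w
  have hkp0 : 0 < k * p := by linarith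
  set κ := k * p with hκ
  have hmpos : 0 < m := by linarith
  have hkpos : 0 < k := by linarith
  have hypos : 0 < y := by linarith
  set y1 := yx + 1 with hy1
  have hy1N : y1 ≤ N := by linarith
  have hy1p : 0 < y1 := by linarith
  have hβ1 : β = 1 + 1 / (N * p - 1) := by
    have : N * p - 1 ≠ 0 := by linarith
    rw [hβ]; field_simp; ring
  have hi : 1 / (N * p - 1) ≤ 1 := by rw [div_le_one (by linarith)]; linarith
  have hi0 : 0 ≤ 1 / (N * p - 1) := by apply div_nonneg <;> linarith
  have hβ0 : 0 ≤ β := by linarith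
  have hβ2 : β ≤ 2 := by linarith
  have hψ := psi_norm (β := β) hz hβ0 hypos (by linarith : y ≤ N)
  have hψ1 := psi_norm (β := β) hz hβ0 hy1p hy1N
  set ψ := psi w β N y with hψdef
  set ψ1 := psi w β N y1 with hψ1def
  set T := (1 + E) ^ 3 with hT
  obtain ⟨hT1, hTE, hTE2, hTE3, hTE4⟩ := tfacts hE
  rw [← hT] at hT1 hTE hTE2 hTE3 hTE4
  set B := 1 / (κ * m) ^ 2 with hB
  have hB0 : 0 ≤ B := by positivity
  have hbad : κ * m / 4 < E → 1 ≤ 16 * E ^ 2 * B := by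
    intro h
    rw [hB, mul_one_div, le_div_iff₀ (by positivity)]
    have h0 : 0 ≤ κ * m := by positivity
    have := pow_le_pow_left₀ h0 (by linarith : κ * m ≤ 4 * E) 2
    linarith [mul_pow 4 E 2]
  have hgood : E ≤ κ * m / 4 → m / 4 ≤ yx := by
    intro h
    have : E / κ ≤ m / 4 := by rw [div_le_iff₀ hkp0]; linarith
    linarith
  -- the factor 1 + w / y1
  have hwy : ‖w / (y1 : ℂ)‖ ≤ ‖w‖ := by
    rw [norm_div, Complex.norm_real, Real.norm_of_nonneg hy1p.le]
    exact div_le_self hw0 (by linarith)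
  have hfac : ‖1 + w / (y1 : ℂ)‖ ≤ 9/8 := (norm_add_le _ _).trans (by simp only [norm_one]; linarith)
  have hfψ : ‖(1 + w / (y1 : ℂ)) * ψ1‖ ≤ 9/8 := by
    rw [norm_mul]
    calc ‖1 + w / (y1 : ℂ)‖ * ‖ψ1‖ ≤ 9/8 * 1 := by gcongr
      _ = 9/8 := by norm_num
  have hk1 : ‖(1 - 1 / k : ℂ)‖ ≤ 1 := by
    have : (1 - 1 / k : ℂ) = ((1 - 1 / k : ℝ) : ℂ) := by push_cast; ring
    have h1 : 1 / k ≤ 1 := by rw [div_le_one hkpos]; exact hk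
    have h2 : 0 < 1 / k := by positivity
    rw [this, Complex.norm_real, Real.norm_of_nonneg (by linarith)]
    linarith
  have hik : ‖(1 / k : ℂ)‖ = 1 / k := by
    rw [norm_div, norm_one, Complex.norm_real, Real.norm_of_nonneg hkpos.le]
  have hik1 : 1 / k ≤ 1 := by rw [div_le_one hkpos]; exact hk
  have hik0 : 0 < 1 / k := by positivity
  -- term 1
  have t1 : ‖(rx - r0) * ((1 / k : ℂ) * (1 + w) + (1 - 1 / k) * ((1 + w / (y1 : ℂ)) * ψ1))‖ ≤
      68 * T * (1 / (k * m) + B) := by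
    have hbr : ‖(1 / k : ℂ) * (1 + w) + (1 - 1 / k) * ((1 + w / (y1 : ℂ)) * ψ1)‖ ≤ 17/8 := by
      refine (norm_add_le _ _).trans ?_
      rw [norm_mul, norm_mul (1 - 1 / k : ℂ), hz, hik]
      calc 1 / k * 1 + ‖(1 - 1 / k : ℂ)‖ * ‖(1 + w / (y1 : ℂ)) * ψ1‖ ≤ 1 * 1 + 1 * (9/8) := by gcongr
        _ = 17/8 := by norm_num
    rw [norm_mul]
    have h0 : ‖rx - r0‖ * ‖(1 / k : ℂ) * (1 + w) + (1 - 1 / k) * ((1 + w / (y1 : ℂ)) * ψ1)‖ ≤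
      ‖rx - r0‖ * (17/8) := by gcongr
    refine h0.trans ?_
    have hkm0 : 0 ≤ 1 / (k * m) := by positivity
    rcases le_or_gt E (κ * m / 4) with h | h
    · have h1 := hgood h
      have h2 : 2 * (E / k) / yx ≤ 2 * (E / k) / (m / 4) := by gcongr
      have h3 : 2 * (E / k) / (m / 4) = 8 * E * (1 / (k * m)) := by field_simp; ring
      have h4 : E * (1 / (k * m)) ≤ T * (1 / (k * m)) := by gcongr
      have h5 : 0 ≤ T * B := by positivity
      have h6 : 0 ≤ T * (1 / (k * m)) := by positivity
      linarith
    · have h1 := hbad h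
      have h2 : ‖rx - r0‖ ≤ 2 := (norm_sub_le _ _).trans (by linarith)
      have h5 : E ^ 2 * B ≤ T * B := by gcongr
      have h6 : 0 ≤ T * (1 / (k * m)) := by positivity
      have h7 : 0 ≤ T * B := by positivity
      linarith
  -- term 2
  have hsq1 : 1 ≤ Real.sqrt (N / m) := by
    rw [Real.one_le_sqrt, le_div_iff₀ hmpos]; linarith
  have t2 : ‖(1 / k : ℂ) * ((1 + w) - (1 + w / (y1 : ℂ)) * ψ1)‖ ≤
      64 * T * (‖w‖ / k * Real.sqrt (N / m) + B) := by
    rw [norm_mul, hik]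
    have hW0 : 0 ≤ ‖w‖ / k * Real.sqrt (N / m) := by positivity
    have h7 : 0 ≤ T * B := by positivity
    rcases le_or_gt E (κ * m / 4) with h | h
    · have h1 := hgood h
      have h2 : ‖ψ1 - 1‖ ≤ 16 * ‖w‖ * Real.sqrt (N / m) := by
        refine (psi_sub_one hz hβ0 hβ2 hy1p hy1N).trans ?_
        have := log_sqrt hmpos (by linarith : m ≤ N)
        have h3 : Real.log (m / 4) ≤ Real.log y1 := Real.log_le_log (by positivity) (by linarith)
        calc 4 * ‖w‖ * (Real.log N - Real.log y1) ≤ 4 * ‖w‖ * (4 * Real.sqrt (N / m)) := by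
              gcongr; linarith
          _ = _ := by ring
      have h3 : (1 + w) - (1 + w / (y1 : ℂ)) * ψ1 = w - (ψ1 - 1) - w / (y1 : ℂ) * ψ1 := by ring
      have h4 : ‖w / (y1 : ℂ) * ψ1‖ ≤ ‖w‖ := by
        rw [norm_mul]
        calc ‖w / (y1 : ℂ)‖ * ‖ψ1‖ ≤ ‖w‖ * 1 := by gcongr
          _ = _ := mul_one _
      have h5 : ‖(1 + w) - (1 + w / (y1 : ℂ)) * ψ1‖ ≤ 18 * (‖w‖ * Real.sqrt (N / m)) := by
        rw [h3]
        refine (norm_sub_le _ _).trans ?_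
        refine (add_le_add (norm_sub_le _ _) le_rfl).trans ?_
        have : ‖w‖ ≤ ‖w‖ * Real.sqrt (N / m) := le_mul_of_one_le_right hw0 hsq1
        linarith
      have h6 : 1 / k * ‖(1 + w) - (1 + w / (y1 : ℂ)) * ψ1‖ ≤ 18 * (‖w‖ / k * Real.sqrt (N / m)) := by
        calc _ ≤ 1 / k * (18 * (‖w‖ * Real.sqrt (N / m))) := by gcongr
          _ = _ := by ring
      have : ‖w‖ / k * Real.sqrt (N / m) ≤ T * (‖w‖ / k * Real.sqrt (N / m)) :=
        le_mul_of_one_le_left hW0 hT1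
      linarith
    · have h1 := hbad h
      have h2 : ‖(1 + w) - (1 + w / (y1 : ℂ)) * ψ1‖ ≤ 17/8 := (norm_sub_le _ _).trans (by linarith)
      have h5 : E ^ 2 * B ≤ T * B := by gcongr
      have h8 : 0 ≤ T * (‖w‖ / k * Real.sqrt (N / m)) := by positivity
      have h9 : 1 / k * ‖(1 + w) - (1 + w / (y1 : ℂ)) * ψ1‖ ≤ 1 * (17/8) := by gcongr
      linarith
  -- term 3
  have hξ1 : y - yx ≤ E := hxi.trans (div_le_self hE hkp)
  have t3 : ‖(1 + w / (y1 : ℂ)) * ψ1 - ψ - ψ * (w / y) * β * ((y - yx - 1 / (N * p) : ℝ) : ℂ)‖ ≤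
      64 * T * (‖w‖ / m ^ 2 + B) := by
    have h7 : 0 ≤ T * B := by positivity
    have hwm : 0 ≤ T * (‖w‖ / m ^ 2) := by positivity
    rcases le_or_gt E (κ * m / 4) with h | h
    · have h1 := hgood h
      set δ := (yx + 1 - y) / y with hδ
      have e1 : y1 = y * (1 + δ) := by rw [hδ, hy1]; field_simp; ring
      have hδy : δ * y = yx + 1 - y := by rw [hδ]; field_simp
      have hξ2 : y - yx ≤ y / 2 := by
        have : E / κ ≤ m / 4 := by rw [div_le_iff₀ hkp0]; linarith
        linarith
      have hδl : -(1/2) ≤ δ := by rw [hδ, le_div_iff₀ hypos]; linarith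
      have hδu : δ ≤ 2 := by rw [hδ, div_le_iff₀ hypos]; linarith
      have hδa : |δ| ≤ 2 * (1 + E) / m := by
        rw [hδ, abs_div, abs_of_pos hypos, div_le_div_iff₀ hypos hmpos]
        have : |yx + 1 - y| ≤ 1 + E := by rw [abs_le]; constructor <;> linarith
        calc |yx + 1 - y| * m ≤ (1 + E) * (2 * y) := by gcongr; linarith
          _ = _ := by ring
      have hrem := rem_bd hw hβ0 hβ2 hypos hδl (by rw [abs_le]; constructor <;> linarith) e1
      have e2 : (w / y - w * β * δ : ℂ) = w / y * β * ((y - yx - 1 / (N * p) : ℝ) : ℂ) := by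
        have h2 : (1 : ℝ) - β * (δ * y) = β * (y - yx - 1 / (N * p)) := by
          rw [hδy]
          have : β * (1 - 1 / (N * p)) = 1 := by
            have : N * p - 1 ≠ 0 := by linarith
            have h9 : N ≠ 0 := by linarith
            have h10 : p ≠ 0 := hp.ne'
            rw [hβ]; field_simp
          linarith
        have hyc : (y : ℂ) ≠ 0 := by exact_mod_cast hypos.ne'
        have h3 : (w / y - w * β * δ : ℂ) = w / y * ((1 - β * (δ * y) : ℝ) : ℂ) := by
          push_cast; field_simp
        rw [h3, h2]; push_cast; ring
      rw [e2] at hrem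
      have e3 : (1 + w / (y1 : ℂ)) * ψ1 - ψ - ψ * (w / y) * β * ((y - yx - 1 / (N * p) : ℝ) : ℂ) =
          ψ * ((1 + w / (y1 : ℂ)) * Complex.exp (-(w * β * Real.log (1 + δ))) - 1 -
            w / y * β * ((y - yx - 1 / (N * p) : ℝ) : ℂ)) := by
        have : ψ1 = ψ * Complex.exp (-(w * β * Real.log (1 + δ))) := by
          rw [hψ1def, e1, psi_mul hypos (by linarith)]
        rw [this]; ring
      rw [e3, norm_mul]
      have h8 : ‖w‖ * (6 * δ ^ 2 + 4 * |δ| / y) ≤ 40 * (T * (‖w‖ / m ^ 2)) := by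
        have a1 : δ ^ 2 ≤ 4 * (1 + E) ^ 2 / m ^ 2 := by
          rw [← sq_abs]
          calc |δ| ^ 2 ≤ (2 * (1 + E) / m) ^ 2 := by gcongr
            _ = _ := by ring
        have a2 : |δ| / y ≤ 4 * (1 + E) ^ 2 / m ^ 2 := by
          calc |δ| / y ≤ (2 * (1 + E) / m) / (m / 2) := by gcongr
            _ = 4 * (1 + E) / m ^ 2 := by field_simp; ring
            _ ≤ _ := by gcongr; exact le_self_pow₀ (by linarith) (by norm_num)
        have a3 : (1 + E) ^ 2 / m ^ 2 ≤ T / m ^ 2 := by gcongr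
        calc ‖w‖ * (6 * δ ^ 2 + 4 * |δ| / y) ≤ ‖w‖ * (40 * (T / m ^ 2)) := by
              refine mul_le_mul_of_nonneg_left ?_ hw0
              have : 4 * |δ| / y = 4 * (|δ| / y) := by ring
              have : 4 * (1 + E) ^ 2 / m ^ 2 = 4 * ((1 + E) ^ 2 / m ^ 2) := by ring
              linarith
          _ = _ := by ring
      refine (mul_le_of_le_one_left (norm_nonneg _) hψ).trans (hrem.trans ?_)
      linarith
    · have h1 := hbad h
      have h2 : ‖(1 + w / (y1 : ℂ)) * ψ1 - ψ‖ ≤ 17/8 := (norm_sub_le _ _).trans (by linarith)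
      have h3 : ‖ψ * (w / y) * β * ((y - yx - 1 / (N * p) : ℝ) : ℂ)‖ ≤ 1 + E := by
        rw [norm_mul, norm_mul, norm_mul, norm_div, Complex.norm_real, Complex.norm_real,
          Complex.norm_real, Real.norm_of_nonneg hypos.le, Real.norm_of_nonneg hβ0, Real.norm_eq_abs]
        have a1 : |y - yx - 1 / (N * p)| ≤ 1 + E := by
          have : 1 / (N * p) ≤ 1 := by rw [div_le_one (by linarith)]; linarith
          have : 0 ≤ 1 / (N * p) := by apply div_nonneg <;> linarith
          rw [abs_le]; constructor <;> linarith
        have a2 : ‖w‖ / y ≤ 1/4 := by rw [div_le_iff₀ hypos]; linarith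
        calc ‖ψ‖ * (‖w‖ / y) * β * |y - yx - 1 / (N * p)| ≤ 1 * (1/4) * 2 * (1 + E) := by gcongr
          _ ≤ _ := by linarith
      refine (norm_sub_le _ _).trans ((add_le_add h2 h3).trans ?_)
      have h5 : (1 + E) * E ^ 2 * B ≤ T * B := by gcongr
      have h6 : (1 + E) * 1 ≤ (1 + E) * (16 * E ^ 2 * B) := by gcongr
      linarith
  -- assemble
  have hdec : ((1 + w) * rx / k + (1 - 1 / k) * (rx * (1 + w / (y1 : ℂ))) * ψ1)
      - r0 * ψ - r0 * ψ * (w / y) * β * ((y - yx - 1 / (N * p) : ℝ) : ℂ) =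
      (rx - r0) * ((1 / k : ℂ) * (1 + w) + (1 - 1 / k) * ((1 + w / (y1 : ℂ)) * ψ1)) +
      (r0 * ((1 / k : ℂ) * ((1 + w) - (1 + w / (y1 : ℂ)) * ψ1)) +
       r0 * ((1 + w / (y1 : ℂ)) * ψ1 - ψ - ψ * (w / y) * β * ((y - yx - 1 / (N * p) : ℝ) : ℂ))) := by
    ring
  rw [hdec]
  have t2' : ‖r0 * ((1 / k : ℂ) * ((1 + w) - (1 + w / (y1 : ℂ)) * ψ1))‖ ≤ 64 * T * (‖w‖ / k * Real.sqrt (N / m) + B) := by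
    rw [norm_mul]; exact (mul_le_of_le_one_left (norm_nonneg _) hr0).trans t2
  have t3' : ‖r0 * ((1 + w / (y1 : ℂ)) * ψ1 - ψ - ψ * (w / y) * β *
      ((y - yx - 1 / (N * p) : ℝ) : ℂ))‖ ≤ 64 * T * (‖w‖ / m ^ 2 + B) := by
    rw [norm_mul]; exact (mul_le_of_le_one_left (norm_nonneg _) hr0).trans t3
  refine (norm_add_le _ _).trans ((add_le_add t1 ((norm_add_le _ _).trans (add_le_add t2' t3'))).trans ?_)
  have c1 : 0 ≤ T * (1 / (k * m)) := by positivity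
  have c2 : 0 ≤ T * (‖w‖ / k * Real.sqrt (N / m)) := by positivity
  have c3 : 0 ≤ T * (‖w‖ / m ^ 2) := by positivity
  have c4 : 0 ≤ T * B := by positivity
  unfold cst
  rw [← hκ, ← hB]
  linarith

end pointwise

section stepan
variable {V : Type*} [DecidableEq V]

lemma H_bd {D C : Finset V} {τ : V} (hτ : τ ∈ C) {a : V → ℝ} (ha : ∀ u ∈ D, 0 < a u) (hD : D.Nonempty)
    {Q p : ℝ} (hQ : 0 ≤ Q) (hp : 0 < p) {c : V → ℂ} {X : V → V → ℂ} {w ψ : ℂ} {Vn : ℝ}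
    (hX1 : ∀ u ∈ D, X u τ = (1 + w) * c u)
    (hX2 : ∀ u ∈ D, ∀ v ∈ C, v ≠ τ → ‖X u v - (((∑ u ∈ D, c u * (a u : ℂ)) + (1 + w) * c u * p) /
      (((∑ u ∈ D, a u) + p : ℝ) : ℂ)) * ψ‖ ≤ Vn) :
    ‖∑ u ∈ D, ∑ v ∈ C, ((Q * a u : ℝ) : ℂ) * X u v -
      ((Q * (C.card * ∑ u ∈ D, a u) : ℝ) : ℂ) *
        ((1 + w) * ((∑ u ∈ D, c u * (a u : ℂ)) / ((∑ u ∈ D, a u : ℝ) : ℂ)) / ((C.card : ℝ) : ℂ) +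
          (1 - 1 / ((C.card : ℝ) : ℂ)) * (((∑ u ∈ D, c u * (a u : ℂ)) / ((∑ u ∈ D, a u : ℝ) : ℂ)) *
            (1 + w / (((∑ u ∈ D, a u) / p + 1 : ℝ) : ℂ))) * ψ)‖ ≤
      Q * (C.card * ∑ u ∈ D, a u) * ((1 - 1 / (C.card : ℝ)) * Vn) := by
  set S := ∑ u ∈ D, a u with hS
  set A := ∑ u ∈ D, c u * (a u : ℂ) with hA
  have hSp : 0 < S := Finset.sum_pos ha hD
  have hk : 0 < (C.card : ℝ) := by exact_mod_cast Finset.card_pos.2 ⟨τ, hτ⟩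
  have hcard : ((C.erase τ).card : ℝ) = C.card - 1 := by
    rw [Finset.card_erase_of_mem hτ, Nat.cast_sub (Finset.card_pos.2 ⟨τ, hτ⟩)]; simp
  set k : ℝ := (C.card : ℝ) with hkd
  let r' : V → ℂ := fun u => (A + (1 + w) * c u * p) / ((S + p : ℝ) : ℂ)
  have hSc : (S : ℂ) ≠ 0 := by exact_mod_cast hSp.ne'
  have hpc : (p : ℂ) ≠ 0 := by exact_mod_cast hp.ne'
  have hkc : (k : ℂ) ≠ 0 := by exact_mod_cast hk.ne'
  have hSpc : ((S + p : ℝ) : ℂ) ≠ 0 := by exact_mod_cast (by positivity : S + p ≠ 0)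
  have hsum : ∑ u ∈ D, (a u : ℂ) * r' u = A * (1 + w / ((S / p + 1 : ℝ) : ℂ)) := by
    have h1 : ∑ u ∈ D, (a u : ℂ) * r' u = (S * A + (1 + w) * p * A) / ((S + p : ℝ) : ℂ) := by
      rw [eq_div_iff hSpc, Finset.sum_mul]
      have : ∀ u ∈ D, (a u : ℂ) * r' u * ((S + p : ℝ) : ℂ) = (a u : ℂ) * A + (1 + w) * p * (c u * a u) := by
        intro u _
        simp only [r']
        rw [mul_assoc, div_mul_cancel₀ _ hSpc]; ring
      rw [Finset.sum_congr rfl this, Finset.sum_add_distrib, ← Finset.sum_mul, ← Finset.mul_sum, ← hA, hS]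
      push_cast; rfl
    have h2 : ((S / p + 1 : ℝ) : ℂ) = ((S + p : ℝ) : ℂ) / p := by
      push_cast; field_simp
    rw [h1, h2]
    field_simp
    push_cast
    ring
  have e : ∑ u ∈ D, ∑ v ∈ C, ((Q * a u : ℝ) : ℂ) * X u v -
      ((Q * (k * S) : ℝ) : ℂ) * ((1 + w) * (A / (S : ℂ)) / (k : ℂ) +
          (1 - 1 / (k : ℂ)) * ((A / (S : ℂ)) * (1 + w / ((S / p + 1 : ℝ) : ℂ))) * ψ) =
      ∑ u ∈ D, ∑ v ∈ C.erase τ, ((Q * a u : ℝ) : ℂ) * (X u v - r' u * ψ) := by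
    have e1 : ∀ u ∈ D, ∑ v ∈ C, ((Q * a u : ℝ) : ℂ) * X u v = (1 + w) * Q * (c u * a u) +
        (Q * (k - 1) * ψ) * ((a u : ℂ) * r' u) +
        ∑ v ∈ C.erase τ, ((Q * a u : ℝ) : ℂ) * (X u v - r' u * ψ) := by
      intro u hu
      rw [← Finset.add_sum_erase C _ hτ, hX1 u hu]
      simp_rw [mul_sub]
      rw [Finset.sum_sub_distrib, Finset.sum_const, nsmul_eq_mul]
      have : (((C.erase τ).card : ℕ) : ℂ) = (k : ℂ) - 1 := by
        have := congrArg (Complex.ofReal) hcard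
        push_cast at this
        rw [this]
      rw [this]; push_cast; ring
    rw [Finset.sum_congr rfl e1, Finset.sum_add_distrib, Finset.sum_add_distrib, ← Finset.mul_sum,
      ← Finset.mul_sum, hsum, ← hA]
    push_cast
    field_simp
    ring
  rw [e]
  refine (norm_sum_le _ _).trans ?_
  calc ∑ u ∈ D, ‖∑ v ∈ C.erase τ, ((Q * a u : ℝ) : ℂ) * (X u v - r' u * ψ)‖
      ≤ ∑ u ∈ D, Q * a u * ((k - 1) * Vn) := by
        refine Finset.sum_le_sum fun u hu => (norm_sum_le _ _).trans ?_
        calc _ ≤ ∑ v ∈ C.erase τ, Q * a u * Vn := by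
              refine Finset.sum_le_sum fun v hv => ?_
              rw [norm_mul, Complex.norm_real, Real.norm_of_nonneg (mul_nonneg hQ (ha u hu).le)]
              exact mul_le_mul_of_nonneg_left (hX2 u hu v (Finset.mem_of_mem_erase hv)
                (Finset.ne_of_mem_erase hv)) (mul_nonneg hQ (ha u hu).le)
          _ = _ := by rw [Finset.sum_const, nsmul_eq_mul, hcard]; ring
    _ = Q * (k * S) * ((1 - 1 / k) * Vn) := by
        rw [← Finset.sum_mul, ← Finset.mul_sum, ← hS]; field_simp

lemma lin_bd {q p k m N y I : ℝ} (W : ℝ) (hW0 : 0 ≤ W) (hW : W ≤ 1/8) (hm : 1 ≤ m) (hk : 1 ≤ k)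
    (hN : m + k = N) (hp : 0 < p) (hp1 : p ≤ 1) (hlam : 2 ≤ N * p)
    (hy0 : m / 2 ≤ y) (hq0 : 0 ≤ q) (hq : q ≤ Real.exp (-(k * p * y)))
    (hI1 : (1 - p) / (k * p) * (1 - q + q * Real.log q) ≤ I)
    (hI2 : I ≤ 1 / (k * p) * (1 - q + q * Real.log q)) :
    q + W / y * 2 * |I - (1 - q) / (N * p)| ≤ 20 * cst W N m k p := by
  have hκ : 0 < k * p := by positivity
  have hmp : 0 < m := by linarith
  have hkp : 0 < k := by linarith
  have hNp : 0 < N := by linarith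
  have hyp : 0 < y := by linarith
  set t := k * p * m with ht
  have htp : 0 < t := by positivity
  have hsq : Real.sqrt q ≤ 4 / t := by
    have h1 : q ≤ Real.exp (-(t / 4)) ^ 2 := by
      refine hq.trans ?_
      rw [← Real.exp_nat_mul]
      refine Real.exp_le_exp.2 ?_
      push_cast
      have : k * p * (m / 2) ≤ k * p * y := by gcongr
      rw [ht]; linarith
    have h2 : Real.sqrt q ≤ Real.exp (-(t / 4)) := Real.sqrt_le_iff.2 ⟨(Real.exp_pos _).le, h1⟩
    have h3 : Real.exp (-(t / 4)) ≤ 4 / t := by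
      rw [Real.exp_neg, inv_le_comm₀ (Real.exp_pos _) (by positivity), inv_div]
      linarith [Real.add_one_le_exp (t / 4)]
    exact h2.trans h3
  have hqq : q ≤ 16 * (1 / t ^ 2) := by
    have : q = Real.sqrt q ^ 2 := (Real.sq_sqrt hq0).symm
    rw [this]
    calc Real.sqrt q ^ 2 ≤ (4 / t) ^ 2 := by gcongr
      _ = _ := by ring
  have hq1 : q ≤ 1 := hq.trans (Real.exp_le_one_iff.2 (by have : 0 < k * p * y := by positivity
                                                          linarith))
  have hql : q * Real.log q ≤ 0 := mul_nonpos_of_nonneg_of_nonpos hq0 (Real.log_nonpos hq0 hq1)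
  have hql2 : -(8 / t) ≤ q * Real.log q := by
    rcases eq_or_lt_of_le hq0 with h | h
    · rw [← h]; simp; positivity
    · have hs : 0 < Real.sqrt q := Real.sqrt_pos.2 h
      have h1 := Real.one_sub_inv_le_log_of_pos hs
      have h2 : Real.log q = 2 * Real.log (Real.sqrt q) := by
        conv_lhs => rw [← Real.sq_sqrt hq0, Real.log_pow]
        norm_num
      have h3 : q * Real.log q ≥ q * (2 * (1 - (Real.sqrt q)⁻¹)) := by
        rw [h2]; exact mul_le_mul_of_nonneg_left (by linarith) hq0
      have h4 : q * (Real.sqrt q)⁻¹ = Real.sqrt q := by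
        rw [← div_eq_mul_inv, Real.div_sqrt]
      have h5 : q * (2 * (1 - (Real.sqrt q)⁻¹)) = 2 * q - 2 * Real.sqrt q := by
        linear_combination (-2) * h4
      have : 8 / t = 2 * (4 / t) := by ring
      linarith
  set M := 1 - q + q * Real.log q with hM
  have habs : |I - (1 - q) / (N * p)| ≤ m / k + 8 / (k * p * t) := by
    have hlam0 : 0 < N * p := by linarith
    have e1 : 1 / (k * p) - 1 / (N * p) = m / k / (N * p) := by
      rw [← hN] at hlam0 ⊢
      have : m + k ≠ 0 := by linarith
      field_simp; ring
    have h1 : 1 / (k * p) * M ≤ 1 / (k * p) * (1 - q) := by gcongr; linarith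
    have h2 : m / k / (N * p) ≤ m / k := div_le_self (by positivity) (by linarith)
    have h0 : 0 ≤ m / k / (N * p) := by positivity
    have h3 : (1 / (k * p) - 1 / (N * p)) * (1 - q) ≤ m / k := by
      rw [e1]; exact (mul_le_of_le_one_right h0 (by linarith)).trans h2
    have h3' : 0 ≤ (1 / (k * p) - 1 / (N * p)) * (1 - q) := by
      rw [e1]; exact mul_nonneg h0 (by linarith)
    have h4 : (1 - p) / (k * p) * M ≥ (1 - p) / (k * p) * (1 - q) - 8 / (k * p * t) := by
      have a1 : (1 - p) / (k * p) * (q * Real.log q) ≥ -(8 / (k * p * t)) := by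
        have a2 : (1 - p) / (k * p) ≤ 1 / (k * p) := by gcongr; linarith
        have a3 : 0 ≤ (1 - p) / (k * p) := div_nonneg (by linarith) hκ.le
        calc -(8 / (k * p * t)) = 1 / (k * p) * (-(8 / t)) := by field_simp
          _ ≤ 1 / (k * p) * (q * Real.log q) := by gcongr
          _ ≤ (1 - p) / (k * p) * (q * Real.log q) := mul_le_mul_of_nonpos_right a2 hql
      rw [hM, mul_add]; linarith
    have h5 : (1 - p) / (k * p) = 1 / (k * p) - 1 / k := by field_simp
    rw [h5] at h4
    have h6 : 1 / k * (1 - q) ≤ m / k := by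
      calc 1 / k * (1 - q) ≤ 1 / k * 1 := by gcongr; linarith
        _ ≤ m / k := by rw [mul_one]; gcongr
    have h7 : 0 ≤ 8 / (k * p * t) := by positivity
    have h8 : (1 - q) / (N * p) = 1 / (N * p) * (1 - q) := by ring
    rw [← h5] at h4
    rw [h8, abs_le]
    rw [h5] at h4 hI1
    constructor <;> nlinarith
  have hWy : W / y ≤ W / (m / 2) := by gcongr
  have hmain : W / y * 2 * |I - (1 - q) / (N * p)| ≤ 4 * (W / k) + 4 * (1 / t ^ 2) := by
    calc W / y * 2 * |I - (1 - q) / (N * p)| ≤ W / (m / 2) * 2 * (m / k + 8 / (k * p * t)) := by gcongr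
      _ = 4 * (W / k) + W * (32 * (1 / t ^ 2)) := by rw [ht]; field_simp; ring
      _ ≤ 4 * (W / k) + 1/8 * (32 * (1 / t ^ 2)) := by gcongr
      _ = _ := by ring
  have hsq1 : 1 ≤ Real.sqrt (N / m) := by
    rw [Real.one_le_sqrt, le_div_iff₀ hmp]; linarith
  have hWk : W / k ≤ W / k * Real.sqrt (N / m) := le_mul_of_one_le_right (by positivity) hsq1
  have c1 : 0 ≤ 1 / (k * m) := by positivity
  have c3 : 0 ≤ W / m ^ 2 := by positivity
  have c2 : 0 ≤ W / k := by positivity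
  unfold cst
  rw [← ht]
  linarith

end stepan

section mainind
variable {V : Type*} [Fintype V] [DecidableEq V]

lemma cube_bd {E : ℝ} (hE : 0 ≤ E) : (1 + E) ^ 3 ≤ 216 * Real.exp (E / 2) := by
  have h1 : 1 + E ≤ 6 * Real.exp (E / 6) := by linarith [Real.add_one_le_exp (E / 6)]
  calc (1 + E) ^ 3 ≤ (6 * Real.exp (E / 6)) ^ 3 := by gcongr
    _ = 216 * Real.exp (E / 2) := by
      rw [mul_pow, ← Real.exp_nat_mul]; push_cast
      rw [show (3:ℝ) * (E / 6) = E / 2 by ring]; norm_num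

lemma sc_bd {K0 k p m y yx E v' : ℝ} (hK1 : 1 ≤ K0) (hk : K0 < k) (hp : 0 < p) (hE : 0 ≤ E)
    (hxi : y - yx ≤ E / (k * p)) (hv : 0 ≤ v') :
    (1 - 1 / k) * (2 * K0 / (k - 1) + v' + 2 * Real.exp (K0 * p / 2 * ((m + 1) / 2 - (yx + 1)))) ≤
      2 * K0 / k + v' + 2 * Real.exp (K0 * p / 2 * (m / 2 - y)) * Real.exp (-(K0 * p / 4)) *
        (1 - K0 / k + K0 / k * Real.exp (E / 2)) := by
  have hk0 : 0 < k := by linarith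
  have hk1 : 0 < k - 1 := by linarith
  have e1 : (1 - 1 / k) * (2 * K0 / (k - 1)) = 2 * K0 / k := by
    field_simp
  have f0 : 0 ≤ 1 - 1 / k := by rw [sub_nonneg, div_le_one hk0]; linarith
  have f1 : 1 - 1 / k ≤ 1 := by have : 0 < 1 / k := by positivity
                                linarith
  have e2 : (1 - 1 / k) * v' ≤ v' := mul_le_of_le_one_left hv f1
  have s1 : K0 / k ≤ 1 := by rw [div_le_one hk0]; linarith
  have cv : Real.exp (K0 / k * (E / 2)) ≤ 1 - K0 / k + K0 / k * Real.exp (E / 2) := by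
    have := convexOn_exp.2 (Set.mem_univ 0) (Set.mem_univ (E / 2)) (sub_nonneg.2 s1)
      (by positivity : 0 ≤ K0 / k) (by ring)
    simpa using this
  have e3 : Real.exp (K0 * p / 2 * ((m + 1) / 2 - (yx + 1))) ≤
      Real.exp (K0 * p / 2 * (m / 2 - y)) * Real.exp (-(K0 * p / 4)) *
        (1 - K0 / k + K0 / k * Real.exp (E / 2)) := by
    refine le_trans ?_ (mul_le_mul_of_nonneg_left cv (by positivity))
    rw [← Real.exp_add, ← Real.exp_add]
    refine Real.exp_le_exp.2 ?_
    have : K0 * p / 2 * (y - yx) ≤ K0 * p / 2 * (E / (k * p)) := by gcongr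
    have e : K0 * p / 2 * (E / (k * p)) = K0 / k * (E / 2) := by field_simp
    rw [e] at this
    linarith
  have e4 : (1 - 1 / k) * (2 * Real.exp (K0 * p / 2 * ((m + 1) / 2 - (yx + 1)))) ≤
      2 * Real.exp (K0 * p / 2 * ((m + 1) / 2 - (yx + 1))) :=
    mul_le_of_le_one_left (by positivity) f1
  rw [mul_add, mul_add, e1]
  linarith

lemma sc2 {K0 k p : ℝ} (hK1 : 1 ≤ K0) (hk : K0 < k) (hp : 0 < p) (hKp : 4 ≤ K0 * p) :
    Real.exp (-(K0 * p / 4)) * (1 + K0 / k) ≤ 1 := by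
  have hk0 : 0 < k := by linarith
  rw [Real.exp_neg, inv_mul_le_iff₀ (Real.exp_pos _), mul_one]
  have h1 := Real.add_one_le_exp (K0 * p / 4)
  have h2 : K0 / k ≤ K0 * p / 4 := by
    rw [div_le_iff₀ hk0]
    have : K0 * p ≤ k * p := by gcongr
    have h3 : 4 ≤ k * p := by linarith
    have : K0 * 4 ≤ K0 * (k * p) := by gcongr
    linarith
  linarith

lemma wavg_norm {D : Finset V} {a : V → ℝ} (ha : ∀ u ∈ D, 0 < a u) {c : V → ℂ} (hc : ∀ u, ‖c u‖ ≤ 1) :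
    ‖(∑ u ∈ D, c u * (a u : ℂ)) / ((∑ u ∈ D, a u : ℝ) : ℂ)‖ ≤ 1 := by
  rw [norm_div, Complex.norm_real, Real.norm_of_nonneg (Finset.sum_nonneg fun u hu => (ha u hu).le)]
  refine div_le_one_of_le₀ ?_ (Finset.sum_nonneg fun u hu => (ha u hu).le)
  refine (norm_sum_le _ _).trans (Finset.sum_le_sum fun u hu => ?_)
  rw [norm_mul, Complex.norm_real, Real.norm_of_nonneg (ha u hu).le]
  exact mul_le_of_le_one_left (ha u hu).le (hc u)

lemma ind_step {p : ℝ} (hp : 0 < p) (hp1 : p ≤ 1) {w : ℂ} (hz : ‖1 + w‖ = 1) (hw : ‖w‖ ≤ 1/8)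
    {N m k β K0 v' y : ℝ} (hβ : β = N * p / (N * p - 1)) (hlam : 2 ≤ N * p)
    (hK1 : 1 ≤ K0) (hKp : 4 ≤ K0 * p)
    {D : Finset V} {η : V → ℝ} {h : Sym2 V → ℝ} (hst : St p D η h) (d : V → ℕ) {τ : V} (hτ : τ ∉ D)
    (hD : D.Nonempty) (hm : m = D.card) (hkd : k = (Dᶜ).card) (hN : m + k = N)
    (hk : K0 < k) (hv : 0 ≤ v') (hyd : y = (∑ u ∈ D, η u) / p) (hy : m / 2 ≤ y)
    (IH : ∀ u ∈ D, ∀ v ∉ D, v ≠ τ → ∀ x, 0 < x → ∀ h',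
      St p (insert v D) (fun a => if a = v then p else hs (η a) x) h' →
      ‖FF (1 + w) (insert v D) (Function.update d v (d u + 1)) τ h' -
        (((∑ a ∈ D, (1 + w) ^ d a * (hs (η a) x : ℂ)) + (1 + w) * (1 + w) ^ d u * p) /
          ((SS D η x + p : ℝ) : ℂ)) * psi w β N (SS D η x / p + 1)‖ ≤
      2 * K0 / (k - 1) + v' + 2 * Real.exp (K0 * p / 2 * ((m + 1) / 2 - (SS D η x / p + 1)))) :
    ‖FF (1 + w) D d τ h - ((∑ u ∈ D, (1 + w) ^ d u * (η u : ℂ)) / ((∑ u ∈ D, η u : ℝ) : ℂ)) *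
      psi w β N y‖ ≤ 2 * K0 / k + (100000 * cst ‖w‖ N m k p + v') +
        2 * Real.exp (K0 * p / 2 * (m / 2 - y)) := by
  obtain ⟨X, hX0, hXF, hX1, hX2⟩ := F_step hp1 hst hp hz d hτ
  have hη : ∀ u ∈ D, 0 < η u ∧ η u ≤ 1 := fun u hu => ⟨(hst.he u hu).1, (hst.he u hu).2.trans hp1⟩
  have hc : ∀ u, ‖(1 + w) ^ d u‖ ≤ 1 := fun u => by rw [norm_pow, hz, one_pow]
  set kk := (Dᶜ).card with hkk
  obtain ⟨q, hq0, hq, iρ, iρE, iρe, Jρ, JρE, Jρe⟩ := moments (k := kk) hη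
  rw [← hkd] at hq
  have hk1 : 1 < k := by linarith
  have hk0 : 0 < k := by linarith
  have hkk0 : 0 < kk := by
    have : (0:ℝ) < (kk:ℝ) := by rw [← hkd]; exact hk0
    exact_mod_cast this
  have hm1 : 1 ≤ m := by rw [hm]; exact_mod_cast Finset.card_pos.2 hD
  have hkp : 4 ≤ k * p := hKp.trans (by gcongr)
  set S0 := ∑ u ∈ D, η u with hS0
  set r0 := (∑ u ∈ D, (1 + w) ^ d u * (η u : ℂ)) / ((S0 : ℝ) : ℂ) with hr0
  have hr0n : ‖r0‖ ≤ 1 := wavg_norm (fun u hu => (hη u hu).1) hc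
  have hym : y ≤ m := by
    rw [hyd, div_le_iff₀ hp, hm, hS0]
    calc ∑ u ∈ D, η u ≤ ∑ u ∈ D, p := Finset.sum_le_sum fun u hu => (hst.he u hu).2
      _ = _ := by simp
  have hy0 : 0 < y := by linarith
  have hS0y : S0 = p * y := by rw [hyd]; field_simp
  have hN0 : 0 < N := by linarith
  have hβ0 : 0 ≤ β := by rw [hβ]; exact div_nonneg (by linarith) (by linarith)
  have hβ2 : β ≤ 2 := by rw [hβ, div_le_iff₀ (by linarith)]; linarith
  have hψ : ‖psi w β N y‖ ≤ 1 := psi_norm hz hβ0 hy0 (by linarith)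
  set ρ := rho D η kk with hρ
  have hρ0 : ∀ x, 0 ≤ ρ x := fun x => rho_nonneg hη x
  set c := cst ‖w‖ N m k p with hcdef
  have hc0 : 0 ≤ c := by rw [hcdef]; unfold cst; positivity
  set P := 2 * Real.exp (K0 * p / 2 * (m / 2 - y)) with hP
  set e4 := Real.exp (-(K0 * p / 4)) with he4
  have hP0 : 0 ≤ P := by positivity
  have he40 : 0 ≤ e4 := by positivity
  have hKk : K0 / k ≤ 1 := by rw [div_le_one hk0]; linarith
  set α := 2 * K0 / k + v' + P * e4 * (1 - K0 / k) with hα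
  have hα0 : 0 ≤ α := by
    have : 0 ≤ P * e4 * (1 - K0 / k) := mul_nonneg (mul_nonneg hP0 he40) (by linarith)
    rw [hα]; positivity
  set γ := P * e4 * (K0 / k) + 43200 * c with hγ
  set Lc : ℂ := r0 * psi w β N y * (w / y) * β with hLc
  -- the pointwise integrand
  set Hf : ℝ → ℂ := fun x => ∑ u ∈ D, ∑ v ∈ Dᶜ, ((QQ D η kk x * hs (η u) x : ℝ) : ℂ) * X u v x with hHf
  have iH : IntegrableOn Hf (Set.Ioi 0) :=
    integrable_finsetSum _ fun u hu => integrable_finsetSum _ fun v hv => hX0 u hu v hv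
  have hF : FF (1 + w) D d τ h = ∫ x in Set.Ioi (0:ℝ), Hf x := by
    rw [hXF, hHf, integral_finsetSum _ (fun u hu => integrable_finsetSum _ fun v hv => hX0 u hu v hv)]
    refine Finset.sum_congr rfl fun u hu => ?_
    rw [integral_finsetSum _ (fun v hv => hX0 u hu v hv)]
  set ξ : ℝ → ℝ := fun x => y - SS D η x / p with hξ
  have hSd := fun x (hx : 0 ≤ x) => SS_diff (k := kk) hp1 hst.he hkk0 hx
  simp only [← hkd] at hSd
  have hEE := fun x (hx : 0 ≤ x) => EE_nonneg (k := kk) hη hx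
  have hSSpos : ∀ x, 0 < SS D η x := fun x =>
    Finset.sum_pos (fun u hu => hs_pos (hη u hu).1 (hη u hu).2) hD
  have hξ1 : ∀ x, 0 ≤ x → ξ x ≤ EE D η kk x / (k * p) := by
    intro x hx
    have := (hSd x hx).2
    simp only [hξ, hyd]
    rw [← sub_div, div_le_iff₀ hp]
    refine this.trans (le_of_eq ?_)
    field_simp
  have hξ2 : ∀ x, 0 ≤ x → (1 - p) / (k * p) * EE D η kk x ≤ ξ x := by
    intro x hx
    have := (hSd x hx).1
    simp only [hξ, hyd]
    rw [← sub_div, le_div_iff₀ hp]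
    refine le_trans (le_of_eq ?_) this
    field_simp
  have hξ0 : ∀ x, 0 ≤ x → 0 ≤ ξ x := fun x hx => le_trans
    (mul_nonneg (div_nonneg (by linarith) (by positivity)) (hEE x hx)) (hξ2 x hx)
  have hSSm : Measurable (SS D η) := by
    have : SS D η = fun x => ∑ u ∈ D, hs (η u) x := rfl
    rw [this]; unfold hs qf; fun_prop
  have iρξ : IntegrableOn (fun x => ρ x * ξ x) (Set.Ioi 0) := by
    refine Integrable.mono' (iρE.const_mul (1 / (k * p))) ?_ ?_
    · exact iρ.aestronglyMeasurable.mul (measurable_const.sub (hSSm.div_const p)).aestronglyMeasurable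
    · refine (ae_restrict_iff' measurableSet_Ioi).2 (ae_of_all _ fun x hx => ?_)
      have hx' : (0:ℝ) ≤ x := le_of_lt hx
      rw [Real.norm_of_nonneg (mul_nonneg (hρ0 x) (hξ0 x hx'))]
      calc ρ x * ξ x ≤ ρ x * (EE D η kk x / (k * p)) := mul_le_mul_of_nonneg_left (hξ1 x hx') (hρ0 x)
        _ = _ := by ring
  set I := ∫ x in Set.Ioi (0:ℝ), ρ x * ξ x with hI
  have hI2 : I ≤ 1 / (k * p) * (1 - q + q * Real.log q) := by
    rw [← JρE, ← integral_const_mul]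
    refine setIntegral_mono_on iρξ (iρE.const_mul _) measurableSet_Ioi fun x hx => ?_
    have hx' : (0:ℝ) ≤ x := le_of_lt hx
    calc ρ x * ξ x ≤ ρ x * (EE D η kk x / (k * p)) := mul_le_mul_of_nonneg_left (hξ1 x hx') (hρ0 x)
        _ = _ := by ring
  have hI1 : (1 - p) / (k * p) * (1 - q + q * Real.log q) ≤ I := by
    rw [← JρE, ← integral_const_mul]
    refine setIntegral_mono_on (iρE.const_mul _) iρξ measurableSet_Ioi fun x hx => ?_
    have hx' : (0:ℝ) ≤ x := le_of_lt hx
    calc _ = ρ x * ((1 - p) / (k * p) * EE D η kk x) := by ring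
        _ ≤ _ := mul_le_mul_of_nonneg_left (hξ2 x hx') (hρ0 x)
  have hlin := lin_bd ‖w‖ (norm_nonneg _) hw hm1 hk1.le hN hp hp1 hlam hy hq0
    (by rw [hS0y, ← mul_assoc] at hq; exact hq) hI1 hI2
  -- the linear part
  set T : ℝ → ℂ := fun x => (ρ x : ℂ) * (r0 * psi w β N y + Lc * ((ξ x - 1 / (N * p) : ℝ) : ℂ)) with hT
  have hTe : T = fun x => (r0 * psi w β N y - Lc * ((1 / (N * p) : ℝ) : ℂ)) * (ρ x : ℂ) +
      Lc * ((ρ x * ξ x : ℝ) : ℂ) := by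
    funext x; simp only [hT]; push_cast; ring
  have iT : IntegrableOn T (Set.Ioi 0) := by
    rw [hTe]; exact (iρ.ofReal.const_mul _).add (iρξ.ofReal.const_mul _)
  have JT : ∫ x in Set.Ioi (0:ℝ), T x = r0 * psi w β N y - (q : ℂ) * (r0 * psi w β N y) +
      Lc * ((I - (1 - q) / (N * p) : ℝ) : ℂ) := by
    rw [hTe, integral_add (iρ.ofReal.const_mul _) (iρξ.ofReal.const_mul _), integral_const_mul,
      integral_const_mul, integral_complex_ofReal, integral_complex_ofReal, Jρ, ← hI]
    push_cast; ring
  have hT2 : ‖(∫ x in Set.Ioi (0:ℝ), T x) - r0 * psi w β N y‖ ≤ 20 * c := by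
    refine le_trans ?_ hlin
    rw [JT]
    have e : r0 * psi w β N y - (q : ℂ) * (r0 * psi w β N y) +
      Lc * ((I - (1 - q) / (N * p) : ℝ) : ℂ) - r0 * psi w β N y =
      -((q : ℂ) * (r0 * psi w β N y)) + Lc * ((I - (1 - q) / (N * p) : ℝ) : ℂ) := by ring
    rw [e]
    have hrψ : ‖r0 * psi w β N y‖ ≤ 1 := by
      rw [norm_mul]; exact mul_le_one₀ hr0n (norm_nonneg _) hψ
    refine (norm_add_le _ _).trans (add_le_add ?_ ?_)
    · rw [norm_neg, norm_mul, Complex.norm_real, Real.norm_of_nonneg hq0]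
      exact mul_le_of_le_one_right hq0 hrψ
    · rw [norm_mul, Complex.norm_real, Real.norm_eq_abs]
      refine mul_le_mul_of_nonneg_right ?_ (abs_nonneg _)
      rw [hLc, norm_mul, norm_mul, Complex.norm_real, Real.norm_of_nonneg hβ0, norm_div,
        Complex.norm_real, Real.norm_of_nonneg hy0.le]
      have : ‖r0 * psi w β N y‖ * (‖w‖ / y) ≤ ‖w‖ / y := mul_le_of_le_one_left (by positivity) hrψ
      exact mul_le_mul this hβ2 hβ0 (by positivity)
  have hpt : ∀ x ∈ Set.Ioi (0:ℝ), ‖Hf x - T x‖ ≤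
      α * ρ x + γ * (ρ x * Real.exp (EE D η kk x / 2)) := by
    intro x hx
    have hx0 : (0:ℝ) < x := hx
    set E := EE D η kk x with hE
    have hE0 : 0 ≤ E := hEE x hx0.le
    have hQ0 : 0 ≤ QQ D η kk x := by rw [QQ_eq hη]; positivity
    have hb := H_bd (D := D) (C := Dᶜ) (τ := τ) (a := fun u => hs (η u) x) (Q := QQ D η kk x) (p := p)
      (c := fun u => (1 + w) ^ d u) (X := fun u v => X u v x) (w := w)
      (ψ := psi w β N (SS D η x / p + 1))
      (Vn := 2 * K0 / (k - 1) + v' + 2 * Real.exp (K0 * p / 2 * ((m + 1) / 2 - (SS D η x / p + 1))))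
      (Finset.mem_compl.2 hτ) (fun u hu => hs_pos (hη u hu).1 (hη u hu).2) hD hQ0 hp
      (fun u hu => by rw [hX1 u hu x hx0, pow_succ, mul_comm])
      (fun u hu v hv hvτ => by
        obtain ⟨h', hs1, hs2⟩ := hX2 u hu v (Finset.mem_compl.1 hv) hvτ x hx0
        rw [hs2]
        exact IH u hu v (Finset.mem_compl.1 hv) hvτ x hx0 h' hs1)
    rw [← hkk, ← hkd] at hb
    have hSS : ∑ u ∈ D, hs (η u) x = SS D η x := rfl
    simp only [hSS] at hb
    have hρx : QQ D η kk x * (k * SS D η x) = ρ x := by rw [hkd, hρ]; rfl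
    rw [hρx] at hb
    set rx := (∑ u ∈ D, (1 + w) ^ d u * (hs (η u) x : ℂ)) / ((SS D η x : ℝ) : ℂ) with hrx
    set yx := SS D η x / p with hyx
    have hyx0 : 0 < yx := div_pos (hSSpos x) hp
    have hpw := pw (w := w) hz hw (N := N) (m := m) (k := k) (p := p) (β := β) (y := y) (yx := yx)
      (E := E) (r0 := r0) (rx := rx) hm1 hk1.le hN hp (by linarith) hβ hlam hy hym hyx0
      (by have := hξ0 x hx0.le; simp only [hξ] at this; linarith) hE0 (hξ1 x hx0.le) hr0n
      (wavg_norm (fun u hu => hs_pos (hη u hu).1 (hη u hu).2) hc)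
      (by
        have := r_diff (k := kk) hp1 hst.he hkk0 hD hx0.le (fun u => (1 + w) ^ d u) hc
        refine this.trans (le_of_eq ?_)
        rw [← hkd, hyx, hE]
        have := hSSpos x
        field_simp)
    have hsc := sc_bd (m := m) hK1 hk hp hE0 (hξ1 x hx0.le : y - yx ≤ _) hv
    rw [← hP, ← he4] at hsc
    have hcb := cube_bd hE0
    set Θ : ℂ := (1 + w) * rx / (k:ℂ) + (1 - 1 / (k:ℂ)) * (rx * (1 + w / ((yx + 1 : ℝ) : ℂ))) *
      psi w β N (yx + 1) with hΘ
    have e1 : Hf x - T x = (Hf x - (ρ x : ℂ) * Θ) + (ρ x : ℂ) *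
        (Θ - r0 * psi w β N y - r0 * psi w β N y * (w / y) * β * ((y - yx - 1 / (N * p) : ℝ) : ℂ)) := by
      simp only [hT, hLc, hξ]; ring
    rw [e1]
    refine (norm_add_le _ _).trans ?_
    rw [norm_mul (ρ x : ℂ), Complex.norm_real, Real.norm_of_nonneg (hρ0 x)]
    calc _ ≤ ρ x * (2 * K0 / k + v' + P * e4 * (1 - K0 / k + K0 / k * Real.exp (E / 2))) +
          ρ x * (200 * (216 * Real.exp (E / 2)) * c) := by
            refine add_le_add (hb.trans ?_) ?_
            · exact mul_le_mul_of_nonneg_left hsc (hρ0 x)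
            · refine mul_le_mul_of_nonneg_left (hpw.trans ?_) (hρ0 x)
              gcongr
      _ = _ := by rw [hα, hγ]; ring
  have hmain : ‖FF (1 + w) D d τ h - ∫ x in Set.Ioi (0:ℝ), T x‖ ≤ α + 2 * γ := by
    rw [hF, ← integral_sub iH iT]
    refine (norm_integral_le_of_norm_le ((iρ.const_mul α).add (iρe.const_mul γ))
      ((ae_restrict_iff' measurableSet_Ioi).2 (ae_of_all _ hpt))).trans ?_
    simp only [Pi.add_apply]
    rw [integral_add (iρ.const_mul α) (iρe.const_mul γ), integral_const_mul, integral_const_mul, Jρ]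
    have hγ0 : 0 ≤ γ := by positivity
    have h1 : α * (1 - q) ≤ α := mul_le_of_le_one_right hα0 (by linarith)
    have h2 : γ * ∫ x in Set.Ioi (0:ℝ), ρ x * Real.exp (EE D η kk x / 2) ≤ γ * 2 :=
      mul_le_mul_of_nonneg_left Jρe hγ0
    linarith
  have hs2 := sc2 hK1 hk hp hKp
  have h3 : P * (e4 * (1 + K0 / k)) ≤ P := mul_le_of_le_one_right hP0 hs2
  have e5 : FF (1 + w) D d τ h - r0 * psi w β N y = (FF (1 + w) D d τ h - ∫ x in Set.Ioi (0:ℝ), T x) +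
    ((∫ x in Set.Ioi (0:ℝ), T x) - r0 * psi w β N y) := by ring
  rw [e5]
  refine (norm_add_le _ _).trans ((add_le_add hmain hT2).trans ?_)
  have e6 : α + 2 * γ = 2 * K0 / k + v' + P * (e4 * (1 + K0 / k)) + 86400 * c := by
    rw [hα, hγ]; ring
  rw [e6]
  linarith

end mainind

section mainind2
variable {V : Type*} [Fintype V] [DecidableEq V]

lemma main_ind {p : ℝ} (hp : 0 < p) (hp1 : p ≤ 1) {w : ℂ} (hz : ‖1 + w‖ = 1) (hw : ‖w‖ ≤ 1/8)
    {N β K0 : ℝ} (hNV : N = Fintype.card V) (hβ : β = N * p / (N * p - 1)) (hlam : 2 ≤ N * p)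
    (hK1 : 1 ≤ K0) (hKp : 4 ≤ K0 * p) (v : ℕ → ℝ) (hv0 : ∀ m : ℕ, (m : ℝ) ≤ N → 0 ≤ v m)
    (hv : ∀ m k : ℕ, 1 ≤ m → (m : ℝ) + k = N → K0 < k →
      100000 * cst ‖w‖ N m k p + v (m + 1) ≤ v m) (τ : V) (n : ℕ) :
    ∀ (D : Finset V) (η : V → ℝ) (h : Sym2 V → ℝ) (d : V → ℕ), St p D η h → τ ∉ D → D.Nonempty →
      (Dᶜ).card = n →
      ‖FF (1 + w) D d τ h - ((∑ u ∈ D, (1 + w) ^ d u * (η u : ℂ)) / ((∑ u ∈ D, η u : ℝ) : ℂ)) *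
        psi w β N ((∑ u ∈ D, η u) / p)‖ ≤ 2 * K0 / n + v D.card +
        2 * Real.exp (K0 * p / 2 * ((D.card : ℝ) / 2 - (∑ u ∈ D, η u) / p)) := by
  induction n with
  | zero =>
    intro D η h d _ hτ _ hc
    exact absurd (Finset.mem_compl.2 hτ) (by rw [Finset.card_eq_zero.1 hc]; simp)
  | succ n ih =>
    intro D η h d hst hτ hD hcard
    have hcs : (D.card : ℝ) + ((n + 1 : ℕ) : ℝ) = N := by
      rw [hNV, ← hcard]; exact_mod_cast Finset.card_add_card_compl D
    have hn0 : (0:ℝ) < ((n + 1 : ℕ) : ℝ) := by positivity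
    have hm1 : 1 ≤ D.card := Finset.card_pos.2 hD
    have hmN : (D.card : ℝ) ≤ N := by linarith
    set y := (∑ u ∈ D, η u) / p with hy
    have hym : y ≤ D.card := by
      rw [hy, div_le_iff₀ hp]
      calc ∑ u ∈ D, η u ≤ ∑ u ∈ D, p := Finset.sum_le_sum fun u hu => (hst.he u hu).2
        _ = _ := by simp
    have hy0 : 0 < y := div_pos (Finset.sum_pos (fun u hu => (hst.he u hu).1) hD) hp
    have hβ0 : 0 ≤ β := by rw [hβ]; exact div_nonneg (by linarith) (by linarith)
    have hψ : ‖psi w β N y‖ ≤ 1 := psi_norm hz hβ0 hy0 (by linarith)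
    have hc : ∀ u, ‖(1 + w) ^ d u‖ ≤ 1 := fun u => by rw [norm_pow, hz, one_pow]
    have hr := wavg_norm (D := D) (fun u hu => (hst.he u hu).1) hc
    have htriv : ‖FF (1 + w) D d τ h - ((∑ u ∈ D, (1 + w) ^ d u * (η u : ℂ)) /
        ((∑ u ∈ D, η u : ℝ) : ℂ)) * psi w β N y‖ ≤ 2 := by
      refine (norm_sub_le _ _).trans ?_
      have h1 := FF_norm (D := D) hst.hh hz d τ
      rw [norm_mul]
      have h2 := mul_le_one₀ hr (norm_nonneg _) hψ
      linarith
    have hvm := hv0 _ hmN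
    have hex := Real.exp_pos (K0 * p / 2 * ((D.card : ℝ) / 2 - y))
    by_cases hk : K0 < ((n + 1 : ℕ) : ℝ)
    swap
    · have : 2 ≤ 2 * K0 / ((n + 1 : ℕ) : ℝ) := by
        rw [le_div_iff₀ hn0]; linarith
      linarith
    by_cases hyy : (D.card : ℝ) / 2 ≤ y
    swap
    · have : 1 ≤ Real.exp (K0 * p / 2 * ((D.card : ℝ) / 2 - y)) :=
        Real.one_le_exp (mul_nonneg (by linarith) (by linarith))
      have : 0 ≤ 2 * K0 / ((n + 1 : ℕ) : ℝ) := by positivity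
      linarith
    have hv1 : 0 ≤ v (D.card + 1) := hv0 _ (by
      push_cast at hcs ⊢
      have : (0:ℝ) ≤ n := by positivity
      linarith)
    refine (ind_step hp hp1 hz hw hβ hlam hK1 hKp hst d hτ hD rfl (by rw [hcard]) hcs hk hv1 hy hyy ?_).trans ?_
    · intro u hu b hb hbτ x hx h' hst'
      have h1 := ih (insert b D) _ h' (Function.update d b (d u + 1)) hst'
        (by simp [hτ, Ne.symm hbτ]) (Finset.insert_nonempty _ _) (by
          have := Finset.card_add_card_compl D
          have h2 := Finset.card_add_card_compl (insert b D)
          rw [Finset.card_insert_of_notMem hb] at h2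
          omega)
      have hne : ∀ a ∈ D, a ≠ b := fun a ha hab => hb (hab ▸ ha)
      have e1 : ∑ a ∈ insert b D, (if a = b then p else hs (η a) x) = SS D η x + p := by
        rw [Finset.sum_insert hb, if_pos rfl, add_comm]
        congr 1
        exact Finset.sum_congr rfl fun a ha => if_neg (hne a ha)
      have e2 : ∑ a ∈ insert b D, (1 + w) ^ (Function.update d b (d u + 1) a) *
          (((if a = b then p else hs (η a) x : ℝ)) : ℂ) =
          (∑ a ∈ D, (1 + w) ^ d a * (hs (η a) x : ℂ)) + (1 + w) * (1 + w) ^ d u * p := by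
        rw [Finset.sum_insert hb, if_pos rfl, add_comm, Function.update_self, pow_succ]
        congr 1
        · refine Finset.sum_congr rfl fun a ha => ?_
          rw [if_neg (hne a ha), Function.update_of_ne (hne a ha)]
        · ring
      rw [e1, e2, Finset.card_insert_of_notMem hb] at h1
      have e3 : (SS D η x + p) / p = SS D η x / p + 1 := by field_simp
      rw [e3] at h1
      push_cast at h1 ⊢
      simpa using h1
    · have := hv D.card (n + 1) hm1 hcs hk
      linarith

end mainind2

section quantsec

lemma sqrt_facts {s t : ℝ} (hs : 1 ≤ s) (ht : 0 ≤ t) (h : t ^ 2 = s ^ 2 + 1) :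
    1 / (4 * (s ^ 2 * s)) ≤ 1 / s - 1 / t ∧ 1 / (3 * s) ≤ t - s := by
  have hs0 : 0 < s := by linarith
  have hst : s < t := by
    refine lt_of_pow_lt_pow_left₀ 2 ht ?_
    linarith
  have ht0 : 0 < t := by linarith
  have hss : 1 ≤ s ^ 2 := one_le_pow₀ hs
  have ht15 : t ≤ 1.5 * s := by
    refine (pow_le_pow_iff_left₀ ht (by positivity) two_ne_zero).1 ?_
    rw [h, mul_pow]; linarith
  have e : (t - s) * (t + s) = 1 := by linear_combination h
  constructor
  · have e1 : 1 / s - 1 / t = 1 / (s * (t * (t + s))) := by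
      have hts : t - s = 1 / (t + s) := by rw [eq_div_iff (by positivity), e]
      have : 1 / s - 1 / t = (t - s) / (s * t) := by field_simp
      rw [this, hts]; field_simp
    rw [e1]
    refine one_div_le_one_div_of_le (by positivity) ?_
    have : t * (t + s) ≤ 4 * s ^ 2 := by
      have : t * s ≤ 1.5 * s * s := by gcongr
      linarith [this, h, (by ring : t * (t + s) = t ^ 2 + t * s), (by ring : 1.5 * s * s = 1.5 * s ^ 2)]
    calc s * (t * (t + s)) ≤ s * (4 * s ^ 2) := by gcongr
      _ = _ := by ring
  · have hts : t - s = 1 / (t + s) := by rw [eq_div_iff (by positivity), e]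
    rw [hts]
    exact one_div_le_one_div_of_le (by positivity) (by linarith)

def vA (W N ε p : ℝ) : ℝ := 400000 * (1 / (ε * Real.sqrt N) + W + 1 / (ε * (N * p)) ^ 2)
def vB (W ε : ℝ) : ℝ := 300000 * (W / ε)
def vf (W N ε p : ℝ) (m : ℕ) : ℝ :=
  vA W N ε p * (1 / Real.sqrt m) + vB W ε * (1 - Real.sqrt m / Real.sqrt N)

lemma vf_step {W N ε p : ℝ} (hW : 0 ≤ W) (hN : 1 ≤ N) (hε : 0 < ε) (hp : 0 < p) (m k : ℕ)
    (hm : 1 ≤ m) (hmk : (m : ℝ) + k = N) (hk : ε * N < k) :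
    100000 * cst W N m k p + vf W N ε p (m + 1) ≤ vf W N ε p m := by
  have hN0 : 0 < N := by linarith
  have hm1 : (1:ℝ) ≤ m := by exact_mod_cast hm
  have hm0 : (0:ℝ) < m := by linarith
  set s := Real.sqrt m with hs
  set t := Real.sqrt ((m + 1 : ℕ) : ℝ) with ht
  set R := Real.sqrt N with hR
  have hs1 : 1 ≤ s := by rw [hs, Real.one_le_sqrt]; exact hm1
  have hs0 : 0 < s := by linarith
  have hs2 : s ^ 2 = m := Real.sq_sqrt hm0.le
  have ht2 : t ^ 2 = s ^ 2 + 1 := by rw [hs2, ht, Real.sq_sqrt (by positivity)]; push_cast; rfl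
  have hR0 : 0 < R := Real.sqrt_pos.2 hN0
  have hR2 : R ^ 2 = N := Real.sq_sqrt hN0.le
  have hk0 : (0:ℝ) < k := lt_trans (by positivity) hk
  have hsR : s ≤ R := Real.sqrt_le_sqrt (by linarith)
  obtain ⟨f1, f2⟩ := sqrt_facts hs1 (Real.sqrt_nonneg _) ht2
  have c1 : 1 / (k * (m:ℝ)) ≤ 1 / (ε * R) * (1 / (s ^ 2 * s)) := by
    rw [← one_div_mul_one_div, ← hs2]
    calc 1 / (k:ℝ) * (1 / s ^ 2) ≤ 1 / (ε * N) * (1 / s ^ 2) := by gcongr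
      _ = s / R * (1 / (ε * R) * (1 / (s ^ 2 * s))) := by rw [← hR2]; field_simp
      _ ≤ 1 * (1 / (ε * R) * (1 / (s ^ 2 * s))) := by
          gcongr; rw [div_le_one hR0]; exact hsR
      _ = _ := one_mul _
  have c2 : W / k * Real.sqrt (N / m) ≤ W / ε * (1 / R) * (1 / s) := by
    rw [Real.sqrt_div hN0.le, ← hR, ← hs]
    calc W / k * (R / s) ≤ W / (ε * N) * (R / s) := by gcongr
      _ = _ := by rw [← hR2]; field_simp
  have c3 : W / (m:ℝ) ^ 2 ≤ W * (1 / (s ^ 2 * s)) := by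
    rw [div_eq_mul_one_div]
    refine mul_le_mul_of_nonneg_left ?_ hW
    rw [← hs2]
    refine one_div_le_one_div_of_le (by positivity) ?_
    calc s ^ 2 * s ≤ s ^ 2 * s * s := le_mul_of_one_le_right (by positivity) hs1
      _ = (s ^ 2) ^ 2 := by ring
  have c4 : 1 / (k * p * (m:ℝ)) ^ 2 ≤ 1 / (ε * (N * p)) ^ 2 * (1 / (s ^ 2 * s)) := by
    rw [one_div_mul_one_div]
    refine one_div_le_one_div_of_le (by positivity) ?_
    rw [mul_pow (k * p)]
    have a1 : (ε * (N * p)) ^ 2 ≤ (k * p) ^ 2 := by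
      rw [← mul_assoc]; gcongr
    have a2 : s ^ 2 * s ≤ (m:ℝ) ^ 2 := by
      rw [← hs2]
      calc s ^ 2 * s ≤ s ^ 2 * s * s := le_mul_of_one_le_right (by positivity) hs1
        _ = (s ^ 2) ^ 2 := by ring
    exact mul_le_mul a1 a2 (by positivity) (by positivity)
  have hA0 : 0 ≤ vA W N ε p := by unfold vA; positivity
  have hB0 : 0 ≤ vB W ε := by unfold vB; positivity
  have g1 : vA W N ε p * (1 / (4 * (s ^ 2 * s))) ≤ vA W N ε p * (1 / s - 1 / t) := by gcongr
  have g2 : vB W ε * (1 / (3 * s) / R) ≤ vB W ε * ((t - s) / R) := by gcongr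
  have g3 : vA W N ε p * (1 / (4 * (s ^ 2 * s))) = 100000 * (1 / (ε * R) * (1 / (s ^ 2 * s)) +
      W * (1 / (s ^ 2 * s)) + 1 / (ε * (N * p)) ^ 2 * (1 / (s ^ 2 * s))) := by
    unfold vA; rw [← one_div_mul_one_div]; ring
  have g4 : vB W ε * (1 / (3 * s) / R) = 100000 * (W / ε * (1 / R) * (1 / s)) := by
    unfold vB; rw [← one_div_mul_one_div]; ring
  have g5 : vf W N ε p m - vf W N ε p (m + 1) = vA W N ε p * (1 / s - 1 / t) + vB W ε * ((t - s) / R) := by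
    unfold vf; rw [← hs, ← ht, ← hR]; ring
  unfold cst
  linarith

variable {V : Type*} [Fintype V] [DecidableEq V]

def hinit (p : ℝ) (e : Sym2 V) : ℝ := if e.IsDiag then 0 else p

lemma quant {p : ℝ} (hp : 0 < p) (hp1 : p ≤ 1) {w : ℂ} (hz : ‖1 + w‖ = 1) (hw : ‖w‖ ≤ 1/8)
    {N β ε : ℝ} (hNV : N = Fintype.card V) (hβ : β = N * p / (N * p - 1)) (hlam : 2 ≤ N * p)
    (hε : 0 < ε) (hK1 : 1 ≤ ε * N) (hKp : 4 ≤ ε * (N * p)) {i j : V} (hij : i ≠ j) :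
    ‖FF (1 + w) {i} (fun _ => 0) j (hinit p) - psi w β N 1‖ ≤
      2 * (ε * N) / (N - 1) + (vA ‖w‖ N ε p + vB ‖w‖ ε) + 2 * Real.exp (-(ε * (N * p) / 4)) := by
  have hN1 : 1 ≤ N := by rw [hNV]; exact_mod_cast Fintype.card_pos_iff.2 ⟨i⟩
  have hB0 : 0 ≤ vB ‖w‖ ε := by unfold vB; positivity
  have hA0 : 0 ≤ vA ‖w‖ N ε p := by unfold vA; positivity
  have hst : St p ({i} : Finset V) (fun _ => p) (hinit p) := by
    refine ⟨?_, ?_, ?_, ?_⟩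
    · intro e; unfold hinit; split_ifs
      · simp
      · exact ⟨hp.le, hp1⟩
    · intro u hu b hb
      have : u ≠ b := fun h => hb (h ▸ hu)
      simp [hinit, this]
    · intro a b ha hb hab
      simp [hinit, hab]
    · intro u _; exact ⟨hp, le_rfl⟩
  have hcc : ((({i} : Finset V)ᶜ).card : ℝ) = N - 1 := by
    have := Finset.card_add_card_compl ({i} : Finset V)
    rw [Finset.card_singleton] at this
    rw [hNV, ← this]; push_cast; ring
  have hmain := main_ind hp hp1 hz hw hNV hβ hlam hK1 (by linarith : 4 ≤ ε * N * p)
    (vf ‖w‖ N ε p) (fun m hm => by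
      unfold vf
      have : Real.sqrt m / Real.sqrt N ≤ 1 :=
        div_le_one_of_le₀ (Real.sqrt_le_sqrt hm) (Real.sqrt_nonneg _)
      have h2 : 0 ≤ vB ‖w‖ ε * (1 - Real.sqrt m / Real.sqrt N) := mul_nonneg hB0 (by linarith)
      have h3 : 0 ≤ vA ‖w‖ N ε p * (1 / Real.sqrt m) := by positivity
      linarith)
    (fun m k hm hmk hk => vf_step (norm_nonneg _) hN1 hε hp m k hm hmk hk) j _
    {i} (fun _ => p) (hinit p) (fun _ => 0) hst (by simpa using Ne.symm hij) (by simp) rfl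
  rw [hcc] at hmain
  simp only [Finset.sum_singleton, pow_zero, one_mul, Finset.card_singleton, div_self hp.ne'] at hmain
  rw [div_self (by exact_mod_cast hp.ne'), one_mul] at hmain
  refine hmain.trans ?_
  have h1 : vf ‖w‖ N ε p 1 ≤ vA ‖w‖ N ε p + vB ‖w‖ ε := by
    unfold vf
    have : 0 ≤ Real.sqrt (1:ℕ) / Real.sqrt N := by positivity
    have h2 : vB ‖w‖ ε * (1 - Real.sqrt (1:ℕ) / Real.sqrt N) ≤ vB ‖w‖ ε :=
      mul_le_of_le_one_right hB0 (by linarith)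
    simp only [Nat.cast_one, Real.sqrt_one, div_one, mul_one] at h2 ⊢
    linarith
  have h2 : ε * N * p / 2 * (((1:ℕ):ℝ) / 2 - 1) = -(ε * (N * p) / 4) := by push_cast; ring
  rw [h2]
  linarith

end quantsec

section lawsec

def wtf {n : ℕ} (e : Sym2 (Fin n)) (q : Bool × ℝ) : ℝ≥0∞ :=
  if ¬ e.IsDiag ∧ q.1 = true then ENNReal.ofReal q.2 else ⊤

lemma measurable_wtf {n : ℕ} (e : Sym2 (Fin n)) : Measurable (wtf e) := by
  unfold wtf
  refine Measurable.ite ?_ (by fun_prop) measurable_const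
  by_cases he : e.IsDiag
  · simp [he]
  · have : {q : Bool × ℝ | ¬ e.IsDiag ∧ q.1 = true} = Prod.fst ⁻¹' {true} := by
      ext q; simp [he]
    rw [this]
    exact measurable_fst (measurableSet_singleton _)

lemma map_wtf {n : ℕ} (e : Sym2 (Fin n)) {p : ℝ} (h0 : 0 ≤ p) (h1 : p ≤ 1) :
    ((bernoulliDist p).prod expDist).map (wtf e) = nu (hinit p e) := by
  have hm := measurable_wtf e
  have m1 : Measurable (Prod.mk true : ℝ → Bool × ℝ) := measurable_prodMk_left
  have m2 : Measurable (Prod.mk false : ℝ → Bool × ℝ) := measurable_prodMk_left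
  rw [bernoulliDist, Measure.add_prod, Measure.prod_smul_left, Measure.prod_smul_left,
    Measure.dirac_prod, Measure.dirac_prod, Measure.map_add _ _ hm, Measure.map_smul, Measure.map_smul,
    Measure.map_map hm m1, Measure.map_map hm m2]
  have e2 : wtf e ∘ Prod.mk false = fun _ => ⊤ := by funext x; simp [wtf]
  rw [e2, Measure.map_const, measure_univ, one_smul]
  by_cases he : e.IsDiag
  · have e1 : wtf e ∘ Prod.mk true = fun _ => ⊤ := by funext x; simp [wtf, he]
    rw [e1, Measure.map_const, measure_univ, one_smul, ← add_smul, ← ENNReal.ofReal_add h0 (by linarith)]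
    simp [hinit, he, nu]
  · have e1 : wtf e ∘ Prod.mk true = ENNReal.ofReal := by funext x; simp [wtf, he]
    rw [e1]
    simp [hinit, he, nu]

variable {n : ℕ} {Ω : Type*} [MeasurableSpace Ω] {μ : Measure Ω} [IsProbabilityMeasure μ]
  {Z : Sym2 (Fin n) → Ω → Bool × ℝ} {p : ℝ}

lemma measurable_wtZ (hZ : ∀ e, Measurable (Z e)) : Measurable (fun ω => wt (fun e => Z e ω)) :=
  measurable_pi_lambda _ fun e => (measurable_wtf e).comp (hZ e)

lemma law_wt (h0 : 0 ≤ p) (h1 : p ≤ 1) (hZ : ∀ e, Measurable (Z e)) (hi : iIndepFun Z μ)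
    (hl : ∀ e, μ.map (Z e) = (bernoulliDist p).prod expDist) :
    μ.map (fun ω => wt (fun e => Z e ω)) = piNu (hinit p) := by
  have hi2 := hi.comp (fun e => wtf e) (fun e => measurable_wtf e)
  have := (iIndepFun_iff_map_fun_eq_pi_map
    (fun e => ((measurable_wtf e).comp (hZ e)).aemeasurable)).1 hi2
  have e1 : (fun ω => wt (fun e => Z e ω)) = fun ω e => (wtf e ∘ Z e) ω := rfl
  rw [e1, this]
  congr 1
  funext e
  rw [← Measure.map_map (measurable_wtf e) (hZ e), hl, map_wtf e h0 h1]

lemma law_FF (h0 : 0 ≤ p) (h1 : p ≤ 1) (hZ : ∀ e, Measurable (Z e)) (hi : iIndepFun Z μ)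
    (hl : ∀ e, μ.map (Z e) = (bernoulliDist p).prod expDist) (i j : Fin n) (z : ℂ) :
    ∫ ω in {ω | (theGraph (fun e => Z e ω)).Reachable i j},
      z ^ hopCount (effWeight (fun e => Z e ω)) i j ∂μ = FF z {i} (fun _ => 0) j (hinit p) := by
  have hms : MeasurableSet {ω | (theGraph (fun e => Z e ω)).Reachable i j} := by
    simp only [reach_iff]
    exact ((measurable_dst _ _ _).comp (measurable_wtZ hZ) (measurableSet_singleton ⊤)).compl
  unfold FF
  rw [← law_wt h0 h1 hZ hi hl, integral_map (measurable_wtZ hZ).aemeasurable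
    (measurable_Phi _ _ _ _).aestronglyMeasurable, ← integral_indicator hms]
  congr 1
  funext ω
  by_cases hr : (theGraph (fun e => Z e ω)).Reachable i j
  · rw [Set.indicator_of_mem (by exact hr), (Phi_eq z (fun e => Z e ω) i j).1 hr]
  · rw [Set.indicator_of_notMem (by exact hr), (Phi_eq z (fun e => Z e ω) i j).2 hr]

lemma measurableSet_reach (hZ : ∀ e, Measurable (Z e)) (i j : Fin n) :
    MeasurableSet {ω | (theGraph (fun e => Z e ω)).Reachable i j} := by
  simp only [reach_iff]
  exact ((measurable_dst _ _ _).comp (measurable_wtZ hZ) (measurableSet_singleton ⊤)).compl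

lemma measurable_hopZ (hZ : ∀ e, Measurable (Z e)) (i j : Fin n) :
    Measurable (fun ω => hopCount (effWeight (fun e => Z e ω)) i j) := by
  simp only [hopCount_eq]
  exact (measurable_hop _ _ _).comp (measurable_wtZ hZ)

end lawsec

section limsec

lemma F_lim {p : ℕ → ℝ} (hp : ∀ n, 0 ≤ p n ∧ p n ≤ 1)
    (hlim : Tendsto (fun n : ℕ => ((n : ℝ) + 2) * p n) atTop atTop)
    {β : ℕ → ℝ} (hβ : ∀ n, β n = (((n : ℝ) + 2) * p n) / (((n : ℝ) + 2) * p n - 1))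
    (w : ℕ → ℂ) (hz : ∀ n, ‖1 + w n‖ = 1) (hw : Tendsto w atTop (nhds 0)) :
    Tendsto (fun n : ℕ => FF (1 + w n) ({0} : Finset (Fin (n + 2))) (fun _ => 0) 1 (hinit (p n)) -
      psi (w n) (β n) ((n : ℝ) + 2) 1) atTop (nhds 0) := by
  rw [tendsto_zero_iff_norm_tendsto_zero]
  rw [Metric.tendsto_atTop']
  intro δ hδ
  have hN : Tendsto (fun n : ℕ => (n : ℝ) + 2) atTop atTop :=
    tendsto_atTop_add_const_right _ _ tendsto_natCast_atTop_atTop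
  set ε := δ / 8 with hε
  have hε0 : 0 < ε := by positivity
  have hwn : Tendsto (fun n => ‖w n‖) atTop (nhds 0) := by simpa using hw.norm
  have hel : Tendsto (fun n : ℕ => ε * (((n : ℝ) + 2) * p n)) atTop atTop := hlim.const_mul_atTop hε0
  have hA : Tendsto (fun n : ℕ => vA ‖w n‖ ((n : ℝ) + 2) ε (p n)) atTop (nhds 0) := by
    unfold vA
    have a1 : Tendsto (fun n : ℕ => 1 / (ε * Real.sqrt ((n : ℝ) + 2))) atTop (nhds 0) := by
      simp only [one_div]
      exact (Tendsto.const_mul_atTop hε0 (Real.tendsto_sqrt_atTop.comp hN)).inv_tendsto_atTop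
    have a2 : Tendsto (fun n : ℕ => 1 / (ε * (((n : ℝ) + 2) * p n)) ^ 2) atTop (nhds 0) := by
      simp only [one_div]
      exact ((tendsto_pow_atTop two_ne_zero).comp hel).inv_tendsto_atTop
    simpa using ((a1.add hwn).add a2).const_mul 400000
  have hB : Tendsto (fun n : ℕ => vB ‖w n‖ ε) atTop (nhds 0) := by
    unfold vB
    simpa using (hwn.div_const ε).const_mul 300000
  have hC : Tendsto (fun n : ℕ => 2 * Real.exp (-(ε * (((n : ℝ) + 2) * p n) / 4))) atTop (nhds 0) := by
    have := (Real.tendsto_exp_neg_atTop_nhds_zero.comp (hel.atTop_div_const (by norm_num : (0:ℝ) < 4))).const_mul 2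
    simpa using this
  have hsum := ((hA.add hB).add hC)
  simp only [add_zero] at hsum
  have ev1 := hsum.eventually (gt_mem_nhds (by positivity : (0:ℝ) < δ / 4))
  have ev2 := hwn.eventually (gt_mem_nhds (by norm_num : (0:ℝ) < 1/8))
  have ev3 := hlim.eventually_ge_atTop 2
  have ev4 := hel.eventually_ge_atTop 4
  have ev5 := (hN.const_mul_atTop hε0).eventually_ge_atTop 1
  have := ev1.and (ev2.and (ev3.and (ev4.and ev5)))
  obtain ⟨n0, hn0⟩ := eventually_atTop.1 this
  refine ⟨n0, fun n hn => ?_⟩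
  obtain ⟨b1, b2, b3, b4, b5⟩ := hn0 n hn.le
  have hN2 : (2:ℝ) ≤ (n:ℝ) + 2 := by linarith [(Nat.cast_nonneg n : (0:ℝ) ≤ n)]
  have hpp : 0 < p n := by
    rcases (hp n).1.eq_or_lt with h | h
    · rw [← h] at b3; norm_num at b3
    · exact h
  have hq := quant (V := Fin (n + 2)) hpp (hp n).2 (hz n) b2.le (N := (n:ℝ) + 2) (by simp) (hβ n) b3
    hε0 b5 b4 (i := 0) (j := 1) (by simp)
  rw [Real.dist_eq, sub_zero, abs_of_nonneg (norm_nonneg _)]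
  refine hq.trans_lt ?_
  have : 2 * (ε * ((n:ℝ) + 2)) / ((n:ℝ) + 2 - 1) ≤ 4 * ε := by
    rw [div_le_iff₀ (by linarith)]
    have : ε * 2 ≤ ε * ((n:ℝ) + 2) := by gcongr
    linarith
  have : 4 * ε = δ / 2 := by rw [hε]; ring
  linarith

lemma exp_lim {L β : ℕ → ℝ} (hL : Tendsto L atTop atTop) (hβ : Tendsto β atTop (nhds 1)) (t : ℝ) :
    Tendsto (fun n => Complex.exp (-(t * (β n * Real.sqrt (L n) : ℝ) * Complex.I)) *
      psi (Complex.exp ((t / Real.sqrt (L n) : ℝ) * Complex.I) - 1) (β n) (Real.exp (L n)) 1)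
      atTop (nhds (Complex.exp (-((t : ℂ) ^ 2 / 2)))) := by
  set θ : ℕ → ℂ := fun n => (t / Real.sqrt (L n) : ℝ) * Complex.I with hθ
  have hsq : Tendsto (fun n => Real.sqrt (L n)) atTop atTop := Real.tendsto_sqrt_atTop.comp hL
  have hr : Tendsto (fun n => (Complex.exp (θ n) - 1 - θ n - θ n ^ 2 / 2) * L n) atTop (nhds 0) := by
    refine squeeze_zero_norm' (a := fun n => |t| ^ 3 / Real.sqrt (L n)) ?_ ?_
    · filter_upwards [hL.eventually_gt_atTop 0, hsq.eventually_ge_atTop |t|, hsq.eventually_gt_atTop 0]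
        with n h1 h2 h3
      have hn : ‖θ n‖ = |t| / Real.sqrt (L n) := by
        simp only [hθ]
        rw [norm_mul, Complex.norm_real, Complex.norm_I, mul_one, Real.norm_eq_abs, abs_div,
          abs_of_pos h3]
      have hle : ‖θ n‖ ≤ 1 := by rw [hn, div_le_one h3]; exact h2
      have hb := Complex.exp_bound hle (n := 3) (by norm_num)
      have e1 : ∑ m ∈ Finset.range 3, θ n ^ m / (Nat.factorial m : ℂ) = 1 + θ n + θ n ^ 2 / 2 := by
        simp [Finset.sum_range_succ, Nat.factorial]
      rw [e1] at hb
      have hb2 : ‖Complex.exp (θ n) - 1 - θ n - θ n ^ 2 / 2‖ ≤ ‖θ n‖ ^ 3 := by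
        rw [show Complex.exp (θ n) - 1 - θ n - θ n ^ 2 / 2 =
          Complex.exp (θ n) - (1 + θ n + θ n ^ 2 / 2) by ring]
        refine hb.trans (mul_le_of_le_one_right (by positivity) ?_)
        norm_num [Nat.factorial]
      rw [norm_mul, Complex.norm_real, Real.norm_of_nonneg h1.le]
      calc _ ≤ ‖θ n‖ ^ 3 * L n := by gcongr
        _ = |t| ^ 3 / Real.sqrt (L n) := by
          rw [hn]
          conv_lhs => rw [← Real.sq_sqrt h1.le]
          rw [Real.sqrt_sq (Real.sqrt_nonneg _)]
          field_simp
    · exact hsq.const_div_atTop _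
  have hmain : Tendsto (fun n => (β n : ℂ) * ((Complex.exp (θ n) - 1 - θ n - θ n ^ 2 / 2) * L n -
      ((t : ℂ) ^ 2 / 2))) atTop (nhds (-((t : ℂ) ^ 2 / 2))) := by
    have hb : Tendsto (fun n => (β n : ℂ)) atTop (nhds 1) := by
      exact_mod_cast (Complex.continuous_ofReal.tendsto 1).comp hβ
    simpa using hb.mul (hr.sub_const ((t : ℂ) ^ 2 / 2))
  have := (Complex.continuous_exp.tendsto _).comp hmain
  refine this.congr' ?_
  filter_upwards [hL.eventually_gt_atTop 0] with n h1
  have h3 : 0 < Real.sqrt (L n) := Real.sqrt_pos.2 h1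
  unfold psi
  simp only [Function.comp]
  rw [← Complex.exp_add, Real.log_exp, Real.log_one, sub_zero]
  congr 1
  have h2 : ((Real.sqrt (L n) : ℝ) : ℂ) ^ 2 = L n := by exact_mod_cast Real.sq_sqrt h1.le
  have h4 : θ n ^ 2 * L n = -(t ^ 2 : ℂ) := by
    simp only [hθ]
    rw [mul_pow, Complex.I_sq, ← h2]
    have : ((Real.sqrt (L n) : ℝ) : ℂ) ≠ 0 := by exact_mod_cast h3.ne'
    push_cast; field_simp
  have h5 : θ n * L n = t * (Real.sqrt (L n) : ℂ) * Complex.I := by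
    simp only [hθ]
    rw [← h2]
    have : ((Real.sqrt (L n) : ℝ) : ℂ) ≠ 0 := by exact_mod_cast h3.ne'
    push_cast; field_simp
  have h6 : ((t / Real.sqrt (L n) : ℝ) : ℂ) * Complex.I = θ n := rfl
  rw [h6]
  push_cast
  linear_combination (-(β n : ℂ) / 2) * h4 - (β n : ℂ) * h5

end limsec

/-- **CLT for the hopcount in the dense regime** (Corollary 1.4(a) of
Bhamidi–van der Hofstad–Hooghiemstra): if `λₙ = n pₙ → ∞` and `βₙ = λₙ/(λₙ-1)`, then the
conditional law of `(Hₙ - βₙ log n)/√(log n)`, given that the two uniformly chosen vertices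
are connected, converges weakly to the standard normal distribution. -/
theorem hopcount_clt_dense
    (p : ℕ → ℝ) (hp : ∀ n, 0 ≤ p n ∧ p n ≤ 1)
    (hlim : Tendsto (fun n : ℕ => ((n : ℝ) + 2) * p n) atTop atTop)
    (β : ℕ → ℝ) (hβ : ∀ n, β n = (((n : ℝ) + 2) * p n) / (((n : ℝ) + 2) * p n - 1))
    (Ω : ℕ → Type) (mΩ : ∀ n, MeasurableSpace (Ω n)) (μ : ∀ n, Measure (Ω n))
    (hμ : ∀ n, IsProbabilityMeasure (μ n))
    (Z : ∀ n, Sym2 (Fin (n + 2)) → Ω n → Bool × ℝ)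
    (hZmeas : ∀ n e, Measurable (Z n e))
    (hindep : ∀ n, iIndepFun (Z n) (μ n))
    (hlaw : ∀ n e, (μ n).map (Z n e) = (bernoulliDist (p n)).prod expDist)
    (H : ∀ n, Ω n → ℕ)
    (hH : ∀ n ω, H n ω = hopCount (effWeight (fun e => Z n e ω)) 0 1)
    (Conn : ∀ n, Set (Ω n))
    (hConn : ∀ n, Conn n = {ω | (theGraph (fun e => Z n e ω)).Reachable 0 1}) :
    ∀ g : ℝ → ℝ, Continuous g → (∃ C, ∀ x, |g x| ≤ C) →
      Tendsto (fun n : ℕ =>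
          ∫ ω, g (((H n ω : ℝ) - β n * Real.log ((n : ℝ) + 2)) /
            Real.sqrt (Real.log ((n : ℝ) + 2))) ∂((μ n)[|Conn n]))
        atTop (nhds (∫ x, g x ∂(gaussianReal 0 1))) := by
  haveI := hμ
  intro g hg ⟨Cg, hCg⟩
  have hN : Tendsto (fun n : ℕ => (n : ℝ) + 2) atTop atTop :=
    tendsto_atTop_add_const_right _ _ tendsto_natCast_atTop_atTop
  have hL : Tendsto (fun n : ℕ => Real.log ((n : ℝ) + 2)) atTop atTop := Real.tendsto_log_atTop.comp hN
  have hβ1 : Tendsto β atTop (nhds 1) := by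
    have h1 : Tendsto (fun n : ℕ => 1 + (((n : ℝ) + 2) * p n - 1)⁻¹) atTop (nhds (1 + 0)) :=
      ((tendsto_atTop_add_const_right _ (-1) hlim).inv_tendsto_atTop).const_add 1
    rw [add_zero] at h1
    refine h1.congr' ?_
    filter_upwards [hlim.eventually_ge_atTop 2] with n hn
    have : ((n : ℝ) + 2) * p n - 1 ≠ 0 := by linarith
    rw [hβ n]; field_simp; ring
  have hmC : ∀ n, MeasurableSet (Conn n) := fun n => by
    rw [hConn]; exact measurableSet_reach (hZmeas n) 0 1
  have hmH : ∀ n, Measurable (H n) := fun n => by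
    have : H n = fun ω => hopCount (effWeight (fun e => Z n e ω)) 0 1 := funext (hH n)
    rw [this]; exact measurable_hopZ (hZmeas n) 0 1
  set F : ℕ → ℂ → ℂ := fun n z => ∫ ω in Conn n, z ^ H n ω ∂(μ n) with hF
  have hFF : ∀ n z, F n z = FF z ({0} : Finset (Fin (n + 2))) (fun _ => 0) 1 (hinit (p n)) := by
    intro n z
    simp only [hF, hH, hConn]
    exact law_FF (hp n).1 (hp n).2 (hZmeas n) (hindep n) (hlaw n) 0 1 z
  -- connection probability
  have hc1 : Tendsto (fun n => F n 1) atTop (nhds 1) := by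
    have h := F_lim hp hlim hβ (fun _ => 0) (by simp) tendsto_const_nhds
    simp only [add_zero, ← hFF] at h
    have h2 := h.add_const 1
    simpa [psi] using h2
  have hF1 : ∀ n, F n 1 = (((μ n).real (Conn n) : ℝ) : ℂ) := by
    intro n; simp [hF]
  have hreal : Tendsto (fun n => (μ n).real (Conn n)) atTop (nhds 1) := by
    have := (Complex.continuous_re.tendsto 1).comp hc1
    simpa [hF1, Function.comp_def] using this
  set Y : ∀ n, Ω n → ℝ := fun n ω => ((H n ω : ℝ) - β n * Real.log ((n : ℝ) + 2)) /
            Real.sqrt (Real.log ((n : ℝ) + 2)) with hY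
  have hmY : ∀ n, Measurable (Y n) := fun n =>
    (((measurable_of_countable (fun k : ℕ => (k : ℝ))).comp (hmH n)).sub_const _).div_const _
  have hpos : ∀ᶠ n in atTop, 0 < (μ n).real (Conn n) := hreal.eventually (lt_mem_nhds one_pos)
  have hprob : ∀ n, 0 < (μ n).real (Conn n) → IsProbabilityMeasure ((μ n)[|Conn n]) := by
    intro n hn
    refine cond_isProbabilityMeasure ?_
    intro h0
    rw [Measure.real, h0] at hn
    simp at hn
  -- laws as probability measures
  obtain ⟨G, hG⟩ : ∃ G : ProbabilityMeasure ℝ, (G : Measure ℝ) = gaussianReal 0 1 :=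
    ⟨⟨gaussianReal 0 1, inferInstance⟩, rfl⟩
  have hex : ∀ n, ∃ Q : ProbabilityMeasure ℝ, 0 < (μ n).real (Conn n) →
      (Q : Measure ℝ) = ((μ n)[|Conn n]).map (Y n) := by
    intro n
    by_cases h : 0 < (μ n).real (Conn n)
    · haveI := hprob n h
      exact ⟨⟨((μ n)[|Conn n]).map (Y n), Measure.isProbabilityMeasure_map (hmY n).aemeasurable⟩,
        fun _ => rfl⟩
    · exact ⟨G, fun h' => absurd h' h⟩
  choose P hPe using hex
  have hconv : Tendsto P atTop (nhds G) := by
    refine ProbabilityMeasure.tendsto_of_tendsto_charFun fun t => ?_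
    have hgt : charFun (G : Measure ℝ) t = Complex.exp (-((t : ℂ) ^ 2 / 2)) := by
      rw [hG, charFun_gaussianReal]
      congr 1
      simp
    rw [hgt]
    set L : ℕ → ℝ := fun n => Real.log ((n : ℝ) + 2) with hLd
    set w : ℕ → ℂ := fun n => Complex.exp ((t / Real.sqrt (L n) : ℝ) * Complex.I) - 1 with hw
    have hzn : ∀ n, ‖1 + w n‖ = 1 := by
      intro n; simp only [hw]; rw [add_sub_cancel, Complex.norm_exp_ofReal_mul_I]
    have hw0 : Tendsto w atTop (nhds 0) := by
      have h1 : Tendsto (fun n => t / Real.sqrt (L n)) atTop (nhds 0) :=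
        (Real.tendsto_sqrt_atTop.comp hL).const_div_atTop _
      have h2 : Continuous (fun x : ℝ => Complex.exp ((x : ℂ) * Complex.I) - 1) := by fun_prop
      have h3 := (h2.tendsto 0).comp h1
      simpa [Function.comp_def, hw] using h3
    have a1 := F_lim hp hlim hβ w hzn hw0
    simp only [← hFF] at a1
    have a2 := exp_lim hL hβ1 t
    have eN : ∀ n : ℕ, Real.exp (L n) = (n : ℝ) + 2 := fun n => Real.exp_log (by positivity)
    simp only [eN] at a2
    set ph : ℕ → ℂ := fun n => Complex.exp (-(t * (β n * Real.sqrt (L n) : ℝ) * Complex.I)) with hph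
    have hphn : ∀ n, ‖ph n‖ = 1 := by
      intro n
      simp only [hph]
      rw [show -((t : ℂ) * (β n * Real.sqrt (L n) : ℝ) * Complex.I) =
        ((-(t * (β n * Real.sqrt (L n))) : ℝ) : ℂ) * Complex.I by push_cast; ring]
      exact Complex.norm_exp_ofReal_mul_I _
    have a3 : Tendsto (fun n => ph n * (F n (1 + w n) - psi (w n) (β n) ((n : ℝ) + 2) 1)) atTop (nhds 0) := by
      rw [tendsto_zero_iff_norm_tendsto_zero] at a1 ⊢
      simpa only [norm_mul, hphn, one_mul] using a1
    have a4 : Tendsto (fun n => ph n * F n (1 + w n) / F n 1) atTop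
        (nhds (Complex.exp (-((t : ℂ) ^ 2 / 2)))) := by
      have h := (a3.add a2).div hc1 one_ne_zero
      simp only [zero_add, div_one] at h
      refine h.congr fun n => ?_
      simp only [Pi.div_apply]
      congr 1
      ring
    refine a4.congr' ?_
    filter_upwards [hpos, hL.eventually_gt_atTop 0] with n hn hLn
    have hs0 : 0 < Real.sqrt (L n) := Real.sqrt_pos.2 hLn
    have hsc : ((Real.sqrt (L n) : ℝ) : ℂ) ≠ 0 := by exact_mod_cast hs0.ne'
    rw [hPe n hn, charFun_apply_real, integral_map (hmY n).aemeasurable (by fun_prop), ProbabilityTheory.cond,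
      integral_smul_measure, hF1]
    have e1 : ∀ ω, Complex.exp (t * (Y n ω) * Complex.I) = ph n * (1 + w n) ^ H n ω := by
      intro ω
      simp only [hw, hph, hY]
      rw [add_sub_cancel, ← Complex.exp_nat_mul, ← Complex.exp_add]
      congr 1
      have h2 : ((Real.sqrt (L n) : ℝ) : ℂ) ^ 2 = L n := by exact_mod_cast Real.sq_sqrt hLn.le
      have h3 : Real.log ((n : ℝ) + 2) = L n := rfl
      rw [h3]
      push_cast
      rw [← h2]
      field_simp
      ring
    simp only [e1]
    rw [integral_const_mul, ENNReal.toReal_inv, Complex.real_smul]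
    simp only [hF, Measure.real]
    push_cast
    rw [div_eq_inv_mul]
  have hfin := (ProbabilityMeasure.tendsto_iff_forall_integral_tendsto.1 hconv)
    (BoundedContinuousFunction.ofNormedAddCommGroup g hg Cg (fun x => by
      rw [Real.norm_eq_abs]; exact hCg x))
  simp only [BoundedContinuousFunction.coe_ofNormedAddCommGroup, hG] at hfin
  refine hfin.congr' ?_
  filter_upwards [hpos] with n hn
  rw [hPe n hn, integral_map (hmY n).aemeasurable hg.measurable.aestronglyMeasurable]

end
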